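/- arXiv:2403.11851 — 3 statements merged into one kernel-verified Lean document; each statement's English description precedes it below -/
import Mathlib

section
/- (Theorem 2.1, de Finetti reduction with fixed marginal) Let n, dA, dR be positive natural numbers and let σ̂ be a positive semidefinite matrix indexed by Fin dA. Let Ψ : (Fin n → Fin dA × Fin dR) → ℂ be a symmetric vector such that the partial trace over the R-systems of |Ψ⟩⟨Ψ| equals σ̂^⊗n. Then there exists a probability measure μ on the space of vectors φ : Fin dA × Fin dR → ℂ (with its Borel σ-algebra) such that: μ-almost every φ is a purification of σ̂ with purifying system Fin dR; every entry of the function φ ↦ |φ⟩⟨φ|^⊗n is μ-integrable; and g_{n, dA·dR} • T − |Ψ⟩⟨Ψ| is positive semidefinite, where T is the matrix with entries T v w = ∫ (|φ⟩⟨φ|^⊗n) v w dμ(φ). -/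
open MeasureTheory
open scoped ComplexOrder

noncomputable section

/-- `n`-fold tensor power of a matrix: entries `(σ^⊗n) v w = ∏ i, σ (v i) (w i)`. -/
def tensorPow {d : Type*} [Fintype d] (σ : Matrix d d ℂ) (n : ℕ) :
    Matrix (Fin n → d) (Fin n → d) ℂ :=
  Matrix.of fun v w => ∏ i, σ (v i) (w i)

/-- Outer product `|ψ⟩⟨ψ|` of a vector. -/
def outer {d : Type*} (ψ : d → ℂ) : Matrix d d ℂ :=
  Matrix.of fun x y => ψ x * (starRingEnd ℂ) (ψ y)

/-- Partial trace over the second factor of a product index type. -/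
def ptrace {a r : Type*} [Fintype r] (M : Matrix (a × r) (a × r) ℂ) : Matrix a a ℂ :=
  Matrix.of fun x y => ∑ z : r, M (x, z) (y, z)

/-- Partial trace over the `r`-systems of a matrix on `n` copies of `a × r`. -/
def ptraceN {a r : Type*} [Fintype r] {n : ℕ}
    (M : Matrix (Fin n → a × r) (Fin n → a × r) ℂ) :
    Matrix (Fin n → a) (Fin n → a) ℂ :=
  Matrix.of fun u u' => ∑ z : Fin n → r, M (fun i => (u i, z i)) (fun i => (u' i, z i))

/-- A vector on `n` systems is symmetric if it is invariant under all permutations. -/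
def SymmetricVec {d : Type*} {n : ℕ} (Ψ : (Fin n → d) → ℂ) : Prop :=
  ∀ (π : Equiv.Perm (Fin n)) (v : Fin n → d), Ψ (v ∘ π) = Ψ v

/-- Entrywise tensor power of a rectangular matrix. -/
def rectTensorPow {a b : Type*} (M : Matrix a b ℂ) (n : ℕ) :
    Matrix (Fin n → a) (Fin n → b) ℂ :=
  Matrix.of fun v w => ∏ i, M (v i) (w i)

lemma rectTensorPow_apply {a b : Type*} (M : Matrix a b ℂ) (n : ℕ) (v : Fin n → a)
    (w : Fin n → b) : rectTensorPow M n v w = ∏ i, M (v i) (w i) := rfl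

lemma rectTensorPow_mul {a b c : Type*} [Fintype b] [DecidableEq b] (M : Matrix a b ℂ)
    (N : Matrix b c ℂ) (n : ℕ) :
    rectTensorPow (M * N) n = rectTensorPow M n * rectTensorPow N n := by
  ext v w
  simp only [rectTensorPow_apply, Matrix.mul_apply, Finset.prod_univ_sum, Fintype.piFinset_univ,
    Finset.prod_mul_distrib]

lemma rectTensorPow_conjTranspose {a b : Type*} (M : Matrix a b ℂ) (n : ℕ) :
    (rectTensorPow M n).conjTranspose = rectTensorPow M.conjTranspose n := by
  ext v w
  simp [rectTensorPow_apply, Matrix.conjTranspose_apply]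

lemma rectTensorPow_diagonal {a : Type*} [DecidableEq a] (x : a → ℂ) (n : ℕ) :
    rectTensorPow (Matrix.diagonal x) n = Matrix.diagonal fun v => ∏ i, x (v i) := by
  ext v w
  by_cases h : v = w
  · subst h
    simp [rectTensorPow_apply]
  · obtain ⟨i, hi⟩ := Function.ne_iff.mp h
    rw [Matrix.diagonal_apply_ne _ h, rectTensorPow_apply]
    exact Finset.prod_eq_zero (Finset.mem_univ i) (Matrix.diagonal_apply_ne _ hi)

lemma exists_perm_of_card_fiber_eq {e : Type*} [DecidableEq e] {n : ℕ} {v w : Fin n → e}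
    (h : ∀ a, Fintype.card {i // v i = a} = Fintype.card {i // w i = a}) :
    ∃ π : Equiv.Perm (Fin n), w ∘ π = v := by
  refine ⟨(Equiv.sigmaFiberEquiv v).symm.trans ((Equiv.sigmaCongrRight fun a =>
    Fintype.equivOfCardEq (h a)).trans (Equiv.sigmaFiberEquiv w)), ?_⟩
  funext i
  exact ((Fintype.equivOfCardEq (h (v i))) ⟨i, rfl⟩).2

lemma sum_single_apply_eq_card {e : Type*} [DecidableEq e] {n : ℕ} (v : Fin n → e) (a : e) :
    (∑ i, Finsupp.single (v i) 1 : e →₀ ℕ) a = Fintype.card {i // v i = a} := by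
  simp [Finsupp.finsetSum_apply, Finsupp.single_apply, Fintype.card_subtype]

/-- A linear functional vanishing on all pure tensor powers vanishes on symmetric tensors. -/
lemma sum_mul_eq_zero_of_pure {e : Type*} [Fintype e] [DecidableEq e] {n : ℕ}
    (F N : (Fin n → e) → ℂ) (hF : ∀ x : e → ℂ, ∑ v, F v * ∏ i, x (v i) = 0)
    (hN : ∀ (π : Equiv.Perm (Fin n)) v, N (v ∘ π) = N v) : ∑ v, F v * N v = 0 := by
  classical
  set c : (Fin n → e) → (e →₀ ℕ) := fun v => ∑ i, Finsupp.single (v i) 1 with hc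
  have hp : (∑ v, MvPolynomial.monomial (c v) (F v)) = 0 := by
    refine MvPolynomial.funext fun x => ?_
    rw [map_zero, ← hF x, map_sum]
    refine Finset.sum_congr rfl fun v _ => ?_
    rw [MvPolynomial.eval_monomial, hc, ← Finsupp.prod_finsetSum_index] <;>
      simp [pow_add]
  have hcoeff : ∀ m, ∑ v with c v = m, F v = 0 := by
    intro m
    have := congrArg (MvPolynomial.coeff m) hp
    simpa [MvPolynomial.coeff_sum, MvPolynomial.coeff_monomial, Finset.sum_filter] using this
  rw [← Finset.sum_fiberwise_of_maps_to (s := Finset.univ) (t := Finset.univ.image c) (g := c)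
    (fun v _ => Finset.mem_image_of_mem _ (Finset.mem_univ v))]
  refine Finset.sum_eq_zero fun m hm => ?_
  obtain ⟨v₀, -, rfl⟩ := Finset.mem_image.mp hm
  have : ∀ v ∈ Finset.univ.filter (fun v => c v = c v₀), F v * N v = F v * N v₀ := by
    intro v hv
    obtain ⟨π, rfl⟩ := exists_perm_of_card_fiber_eq (v := v) (w := v₀) fun a => by
      rw [← sum_single_apply_eq_card, ← sum_single_apply_eq_card]
      exact DFunLike.congr_fun (Finset.mem_filter.mp hv).2 a
    rw [hN]
  rw [Finset.sum_congr rfl this, ← Finset.sum_mul, hcoeff, zero_mul]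

section UnitarySpan

variable {d : Type*} [Fintype d] [DecidableEq d] {n : ℕ} (F : (Fin n → d) → (Fin n → d) → ℂ)
  (hF : ∀ U ∈ Matrix.unitaryGroup d ℂ, ∑ v, ∑ w, F v w * rectTensorPow U n v w = 0)

include hF

lemma sum_mul_rectTensorPow_unitary_diagonal {U : Matrix d d ℂ}
    (hU : U ∈ Matrix.unitaryGroup d ℂ) (z : d → ℂ) :
    ∑ v, ∑ w, F v w * rectTensorPow (U * Matrix.diagonal z * star U) n v w = 0 := by
  set p : MvPolynomial d ℂ := ∑ v, ∑ w, MvPolynomial.C (F v w) *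
    ∏ i, ∑ k, MvPolynomial.C (U (v i) k) * MvPolynomial.X k * MvPolynomial.C (star U k (w i))
  have hp : ∀ x, MvPolynomial.eval x p =
      ∑ v, ∑ w, F v w * rectTensorPow (U * Matrix.diagonal x * star U) n v w := by
    intro x
    simp only [rectTensorPow_apply, Matrix.mul_apply (M := U * Matrix.diagonal x),
      Matrix.mul_diagonal]
    simp [p]
  rw [← hp]
  have : p = 0 := by
    refine MvPolynomial.funext_set (fun _ => Metric.sphere (0 : ℂ) 1) (fun _ => ?_) fun x hx => ?_
    · refine (isPreconnected_sphere ?_ 0 1).infinite_of_nontrivial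
        ⟨1, by simp, -1, by simp, by norm_num⟩
      rw [Complex.rank_real_complex]
      exact Cardinal.one_lt_two
    · rw [hp, map_zero]
      refine hF _ (mul_mem (mul_mem hU ?_) (Unitary.star_mem hU))
      rw [Matrix.mem_unitaryGroup_iff, Matrix.star_eq_conjTranspose,
        Matrix.diagonal_conjTranspose, Matrix.diagonal_mul_diagonal, ← Matrix.diagonal_one]
      congr 1
      funext i
      have hi : ‖x i‖ = 1 := by simpa using hx i (Set.mem_univ i)
      simp [Complex.mul_conj, Complex.normSq_eq_norm_sq, hi]
  rw [this, map_zero]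

lemma sum_mul_rectTensorPow_isHermitian {H : Matrix d d ℂ} (hH : H.IsHermitian) :
    ∑ v, ∑ w, F v w * rectTensorPow H n v w = 0 := by
  rw [hH.spectral_theorem]
  exact sum_mul_rectTensorPow_unitary_diagonal F hF hH.eigenvectorUnitary.2 _

lemma sum_mul_rectTensorPow (A : Matrix d d ℂ) :
    ∑ v, ∑ w, F v w * rectTensorPow A n v w = 0 := by
  set H : Matrix d d ℂ := (1 / 2 : ℂ) • (A + A.conjTranspose) with hHdef
  set K : Matrix d d ℂ := (-Complex.I / 2) • (A - A.conjTranspose) with hKdef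
  have hH : H.IsHermitian := by
    simp [Matrix.IsHermitian, hHdef, Matrix.conjTranspose_smul, add_comm]
  have hK : K.IsHermitian := by
    ext i j
    simp [hKdef, Matrix.conjTranspose_apply]
    ring
  have hA : A = H + Complex.I • K := by
    ext i j
    simp [hHdef, hKdef]
    linear_combination (A i j / 2 - (starRingEnd ℂ (A j i)) / 2) * Complex.I_sq
  set p : Polynomial ℂ := ∑ v, ∑ w, Polynomial.C (F v w) *
    ∏ i, (Polynomial.C (H (v i) (w i)) + Polynomial.X * Polynomial.C (K (v i) (w i)))
  have hp : ∀ x, Polynomial.eval x p =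
      ∑ v, ∑ w, F v w * rectTensorPow (H + x • K) n v w := by
    intro x
    simp [p, rectTensorPow_apply, mul_comm x, Polynomial.eval_finsetSum, Polynomial.eval_prod]
  have : p = 0 := by
    refine Polynomial.eq_zero_of_infinite_isRoot _ ((Set.infinite_range_of_injective
      Complex.ofReal_injective).mono ?_)
    rintro _ ⟨t, rfl⟩
    change Polynomial.eval _ p = 0
    rw [hp]
    refine sum_mul_rectTensorPow_isHermitian F hF (hH.add ?_)
    rw [Matrix.IsHermitian, Matrix.conjTranspose_smul, hK.eq]
    simp
  rw [hA, ← hp, this, Polynomial.eval_zero]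

/-- A linear functional vanishing on all tensor powers of unitaries vanishes on all
permutation-invariant matrices. -/
lemma sum_mul_eq_zero_of_unitary (N : Matrix (Fin n → d) (Fin n → d) ℂ)
    (hN : ∀ (π : Equiv.Perm (Fin n)) v w, N (v ∘ π) (w ∘ π) = N v w) :
    ∑ v, ∑ w, F v w * N v w = 0 := by
  have key := sum_mul_eq_zero_of_pure (e := d × d) (n := n)
    (fun v => F (fun i => (v i).1) (fun i => (v i).2))
    (fun v => N (fun i => (v i).1) (fun i => (v i).2))
    (fun x => by
      rw [← sum_mul_rectTensorPow F hF (Matrix.of fun i j => x (i, j)), ← Fintype.sum_prod_type']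
      exact Fintype.sum_equiv
        (Equiv.arrowProdEquivProdArrow (Fin n) (fun _ => d) (fun _ => d)) _ _ fun v => rfl)
    (fun π v => hN π (fun i => (v i).1) (fun i => (v i).2))
  rw [← Fintype.sum_prod_type', ← key]
  exact (Fintype.sum_equiv (Equiv.arrowProdEquivProdArrow (Fin n) (fun _ => d) (fun _ => d))
    _ _ fun v => rfl).symm

end UnitarySpan

open scoped Matrix

lemma trace_mul_vecMulVec_star_nonneg {D : Type*} [Fintype D] {R : Matrix D D ℂ}
    (hR : R.PosSemidef) (x : D → ℂ) : 0 ≤ (R * Matrix.vecMulVec x (star x)).trace := by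
  rw [Matrix.mul_vecMulVec, Matrix.trace_vecMulVec, dotProduct_comm]
  exact hR.dotProduct_mulVec_nonneg x

/-- If `R` inverts `T + ε`, where `T` is supported on the symmetric subspace, then the trace of
`R * T` is at most the dimension of the symmetric subspace. -/
lemma trace_mul_le_choose {e : Type*} [Fintype e] [DecidableEq e] {n : ℕ}
    {T R : Matrix (Fin n → e) (Fin n → e) ℂ} {ε : ℝ} (hε : 0 ≤ ε)
    (hT : ∀ (π : Equiv.Perm (Fin n)) v w, T v (w ∘ π) = T v w) (hR : R.PosSemidef)
    (hRT : R * T = 1 - (ε : ℂ) • R) :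
    (R * T).trace ≤ ((n + Fintype.card e - 1).choose n : ℂ) := by
  classical
  set q : (Fin n → e) → Sym e n := fun v => ⟨Finset.univ.val.map v, by simp⟩ with hq
  have hperm : ∀ v w, q v = q w → ∃ π : Equiv.Perm (Fin n), w ∘ π = v := by
    intro v w h
    refine exists_perm_of_card_fiber_eq fun a => ?_
    have := congrArg (Multiset.count a) (congrArg Subtype.val h)
    simp only [hq, Multiset.count_map] at this
    simpa [Fintype.card_subtype, Finset.card_def, eq_comm (a := a)] using this
  set c : Sym e n → ℕ := fun s => Fintype.card {v // q v = s} with hc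
  set x : Sym e n → (Fin n → e) → ℂ := fun s v => if q v = s then 1 else 0 with hx
  set P : Matrix (Fin n → e) (Fin n → e) ℂ :=
    ∑ s, ((c s : ℂ)⁻¹) • Matrix.vecMulVec (x s) (star (x s)) with hP
  have hxsum : ∀ s, ∑ v, x s v = c s := by
    intro s
    simp [hx, hc, Fintype.card_subtype]
  have hTP : T * P = T := by
    ext v w
    have hw : (c (q w) : ℂ) ≠ 0 := by
      rw [Nat.cast_ne_zero]
      exact (Fintype.card_pos_iff.mpr ⟨⟨w, rfl⟩⟩).ne'
    have hPapp : ∀ u, P u w = (c (q w) : ℂ)⁻¹ * x (q w) u := by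
      intro u
      simp [hP, hx, Matrix.sum_apply, Matrix.vecMulVec_apply]
    have hterm : ∀ u, T v u * P u w = T v w * (c (q w) : ℂ)⁻¹ * x (q w) u := by
      intro u
      rw [hPapp]
      by_cases h : q u = q w
      · obtain ⟨π, rfl⟩ := hperm u w h
        rw [hT]
        ring
      · simp [hx, h]
    rw [Matrix.mul_apply, Finset.sum_congr rfl fun u _ => hterm u, ← Finset.mul_sum, hxsum,
      mul_assoc, inv_mul_cancel₀ hw, mul_one]
  have hPtr : P.trace ≤ ((n + Fintype.card e - 1).choose n : ℂ) := by
    have h1 : P.trace = ∑ s, (c s : ℂ)⁻¹ * c s := by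
      rw [hP, Matrix.trace_sum]
      refine Finset.sum_congr rfl fun s _ => ?_
      rw [Matrix.trace_smul, Matrix.trace_vecMulVec, smul_eq_mul, ← hxsum]
      congr 1
      refine Finset.sum_congr rfl fun v _ => ?_
      simp [hx]
    rw [h1, add_comm n, ← Sym.card_sym_eq_choose, ← Finset.card_univ, ← nsmul_one]
    refine Finset.sum_le_card_nsmul _ _ _ fun s _ => ?_
    by_cases h : (c s : ℂ) = 0
    · simp [h]
    · rw [inv_mul_cancel₀ h]
  have hRP : 0 ≤ (R * P).trace := by
    rw [hP, Matrix.mul_sum, Matrix.trace_sum]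
    refine Finset.sum_nonneg fun s _ => ?_
    rw [Matrix.mul_smul, Matrix.trace_smul]
    exact smul_nonneg (inv_nonneg.mpr (Nat.cast_nonneg _))
      (trace_mul_vecMulVec_star_nonneg hR _)
  calc (R * T).trace = P.trace - (ε : ℂ) * (R * P).trace := by
        rw [← hTP, ← mul_assoc, hRT, sub_mul, one_mul, Matrix.smul_mul, Matrix.trace_sub,
          Matrix.trace_smul, smul_eq_mul]
    _ ≤ P.trace := sub_le_self _ (mul_nonneg (Complex.zero_le_real.mpr hε) hRP)
    _ ≤ _ := hPtr

/-- A vector whose quadratic form under `S⁻¹` is at most `g` is dominated by `g • S`. -/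
lemma posSemidef_smul_sub_vecMulVec {D : Type*} [Fintype D] [DecidableEq D] {S : Matrix D D ℂ}
    (hS : S.PosDef) {x : D → ℂ} {g : ℝ} (hg : 0 < g) (hx : star x ⬝ᵥ (S⁻¹ *ᵥ x) ≤ (g : ℂ)) :
    ((g : ℂ) • S - Matrix.vecMulVec x (star x)).PosSemidef := by
  have hgC : (g : ℂ) ≠ 0 := by exact_mod_cast hg.ne'
  set E : Matrix Unit Unit ℂ := Matrix.diagonal fun _ => (g : ℂ) with hE
  have hEpos : E.PosDef := Matrix.PosDef.diagonal fun _ => by exact_mod_cast hg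
  have hEinv : E⁻¹ = (g : ℂ)⁻¹ • (1 : Matrix Unit Unit ℂ) := by
    refine Matrix.inv_eq_right_inv ?_
    ext
    simp [hE, hgC]
  let := hS.isUnit.invertible
  let := hEpos.isUnit.invertible
  set B : Matrix D Unit ℂ := Matrix.replicateCol Unit x with hB
  have h1 : (E - Bᴴ * S⁻¹ * B).PosSemidef := by
    have : E - Bᴴ * S⁻¹ * B =
        Matrix.diagonal fun _ => (g : ℂ) - star x ⬝ᵥ (S⁻¹ *ᵥ x) := by
      ext
      simp [hE, hB, Matrix.mul_assoc, Matrix.mul_apply, dotProduct, Matrix.mulVec]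
    rw [this]
    exact Matrix.PosSemidef.diagonal fun _ => sub_nonneg.mpr hx
  have h2 : (S - B * E⁻¹ * Bᴴ).PosSemidef :=
    (Matrix.PosDef.fromBlocks₂₂ S B hEpos).mp ((Matrix.PosDef.fromBlocks₁₁ B E hS).mpr h1)
  have h3 : (g : ℂ) • S - Matrix.vecMulVec x (star x) = (g : ℂ) • (S - B * E⁻¹ * Bᴴ) := by
    rw [hEinv]
    ext v w
    simp [hB, Matrix.mul_apply, Matrix.vecMulVec_apply, mul_sub, hgC]
  rw [h3]
  exact h2.smul (by exact_mod_cast hg.le)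

lemma posSemidef_of_forall_add_smul_one {D : Type*} [Fintype D] [DecidableEq D]
    {M : Matrix D D ℂ} {g : ℝ}
    (h : ∀ ε : ℝ, 0 < ε → (M + (g * ε : ℂ) • (1 : Matrix D D ℂ)).PosSemidef) :
    M.PosSemidef := by
  have hlim : ∀ v w, Filter.Tendsto (fun ε : ℝ => (M + (g * ε : ℂ) • (1 : Matrix D D ℂ)) v w)
      (nhdsWithin 0 (Set.Ioi 0)) (nhds (M v w)) := by
    intro v w
    have : Continuous fun ε : ℝ => (M + (g * ε : ℂ) • (1 : Matrix D D ℂ)) v w := by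
      simp only [Matrix.add_apply, Matrix.smul_apply]
      fun_prop
    simpa using (this.tendsto 0).mono_left nhdsWithin_le_nhds
  have hev : ∀ᶠ ε : ℝ in nhdsWithin 0 (Set.Ioi 0),
      (M + (g * ε : ℂ) • (1 : Matrix D D ℂ)).PosSemidef :=
    Filter.eventually_of_mem self_mem_nhdsWithin h
  refine Matrix.PosSemidef.of_dotProduct_mulVec_nonneg ?_ fun x => ?_
  · ext v w
    refine tendsto_nhds_unique_of_eventuallyEq ((hlim w v).star) (hlim v w) ?_
    filter_upwards [hev] with ε hε
    exact hε.isHermitian.apply v w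
  · refine ge_of_tendsto (f := fun ε : ℝ =>
      star x ⬝ᵥ ((M + (g * ε : ℂ) • (1 : Matrix D D ℂ)) *ᵥ x)) ?_
      (hev.mono fun ε hε => hε.dotProduct_mulVec_nonneg x)
    refine tendsto_finsetSum _ fun v _ => tendsto_const_nhds.mul ?_
    exact tendsto_finsetSum _ fun w _ => (hlim v w).mul tendsto_const_nhds

lemma card_le_of_mul_conjTranspose_eq_diagonal {s r : Type*} [Fintype s] [DecidableEq s]
    [Fintype r] [DecidableEq r] {x : s → ℂ} (hx : ∀ i, x i ≠ 0) {N : Matrix s r ℂ}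
    (h : N * Nᴴ = Matrix.diagonal x) : Fintype.card s ≤ Fintype.card r := by
  have hu : IsUnit (Matrix.diagonal x) := by
    rw [Matrix.isUnit_diagonal, Pi.isUnit_iff]
    exact fun i => (hx i).isUnit
  rw [← Matrix.rank_of_isUnit _ hu, ← h]
  exact (Matrix.rank_mul_le_left _ _).trans (Matrix.rank_le_card_width _)

/-- If `σ^⊗n` has a purification on `n` copies of `r`, then `σ` factors as `L * Lᴴ` with `L`
having `r` columns. -/
lemma exists_factorization {a r : Type*} [Fintype a] [DecidableEq a] [Fintype r] [DecidableEq r]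
    {n : ℕ} (hn : n ≠ 0) {σ : Matrix a a ℂ} (hσ : σ.PosSemidef)
    {W : Matrix (Fin n → a) (Fin n → r) ℂ} (hW : W * Wᴴ = rectTensorPow σ n) :
    ∃ (L : Matrix a r ℂ) (Q : Matrix r a ℂ), L * Lᴴ = σ ∧ L * Q * σ = σ := by
  classical
  set V : Matrix a a ℂ := (hσ.isHermitian.eigenvectorUnitary).1 with hV
  set l : a → ℝ := hσ.isHermitian.eigenvalues with hl
  have hVV : star V * V = 1 := Unitary.coe_star_mul_self _
  have hspec : σ = V * Matrix.diagonal (fun i => (l i : ℂ)) * star V :=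
    hσ.isHermitian.spectral_theorem
  have hl0 : ∀ i, 0 ≤ l i := hσ.eigenvalues_nonneg
  have hcard : Fintype.card {i // l i ≠ 0} ≤ Fintype.card r := by
    set N : Matrix (Fin n → {i // l i ≠ 0}) (Fin n → r) ℂ :=
      (rectTensorPow (star V) n * W).submatrix (fun f i => (f i).1) id with hN
    have hNN : N * Nᴴ = Matrix.diagonal fun f => ∏ i, (l (f i).1 : ℂ) := by
      have h1 : rectTensorPow (star V) n * W * (rectTensorPow (star V) n * W)ᴴ =
          Matrix.diagonal fun v => ∏ i, (l (v i) : ℂ) := by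
        rw [Matrix.conjTranspose_mul, rectTensorPow_conjTranspose,
          ← rectTensorPow_diagonal fun i => (l i : ℂ)]
        calc _ = rectTensorPow (star V) n * (W * Wᴴ) * rectTensorPow (star V)ᴴ n := by
              simp only [Matrix.mul_assoc]
          _ = _ := by
              rw [hW, ← rectTensorPow_mul, ← rectTensorPow_mul, hspec,
                ← Matrix.star_eq_conjTranspose, star_star]
              congr 1
              calc star V * (V * Matrix.diagonal (fun i => (l i : ℂ)) * star V) * V
                  = (star V * V) * Matrix.diagonal (fun i => (l i : ℂ)) * (star V * V) := by
                    simp only [Matrix.mul_assoc]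
                _ = _ := by rw [hVV, one_mul, mul_one]
      rw [hN, Matrix.conjTranspose_submatrix,
        ← Matrix.submatrix_mul _ _ _ _ _ Function.bijective_id,
        h1,
        Matrix.submatrix_diagonal]
      · rfl
      · intro f g hfg
        funext i
        exact Subtype.ext (congrFun hfg i)
    have := card_le_of_mul_conjTranspose_eq_diagonal
      (fun f => Finset.prod_ne_zero_iff.mpr fun i _ => Complex.ofReal_ne_zero.mpr (f i).2) hNN
    simp only [Fintype.card_fun, Fintype.card_fin] at this
    exact (Nat.pow_le_pow_iff_left hn).mp this
  obtain ⟨ι⟩ := Function.Embedding.nonempty_of_card_le hcard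
  set J : Matrix a r ℂ :=
    Matrix.of fun i j => if h : l i ≠ 0 then (if ι ⟨i, h⟩ = j then 1 else 0) else 0 with hJ
  have hJJ : J * Jᴴ = Matrix.diagonal fun i => if l i ≠ 0 then 1 else 0 := by
    ext i j
    rw [Matrix.mul_apply, Matrix.diagonal_apply]
    by_cases hi : l i = 0
    · simp [hJ, hi]
    · by_cases hj : l j = 0
      · have : i ≠ j := fun h => hi (h ▸ hj)
        simp [hJ, hj, this]
      · by_cases hij : i = j <;>
          simp [hJ, hi, hj, hij]
  set Λ : Matrix a a ℂ := Matrix.diagonal fun i => (Real.sqrt (l i) : ℂ) with hΛ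
  set Λ' : Matrix a a ℂ := Matrix.diagonal fun i => ((Real.sqrt (l i))⁻¹ : ℂ) with hΛ'
  have hsq : ∀ i, (Real.sqrt (l i) : ℂ) * Real.sqrt (l i) = l i := fun i => by
    rw [← Complex.ofReal_mul, Real.mul_self_sqrt (hl0 i)]
  refine ⟨V * Λ * J, Jᴴ * Λ' * star V, ?_, ?_⟩
  · calc V * Λ * J * (V * Λ * J)ᴴ = V * (Λ * (J * Jᴴ) * Λᴴ) * star V := by
          simp only [Matrix.conjTranspose_mul, Matrix.mul_assoc, Matrix.star_eq_conjTranspose]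
      _ = σ := by
          rw [hspec, hJJ, hΛ, Matrix.diagonal_conjTranspose, Matrix.diagonal_mul_diagonal,
            Matrix.diagonal_mul_diagonal]
          congr 3
          funext i
          by_cases hi : l i = 0
          · simp [hi]
          · simp [hi, hsq]
  · calc V * Λ * J * (Jᴴ * Λ' * star V) * σ
        = V * (Λ * (J * Jᴴ) * Λ') * (star V * V) * Matrix.diagonal (fun i => (l i : ℂ)) *
            star V := by
          conv_lhs => rw [hspec]
          simp only [Matrix.mul_assoc]
      _ = V * (Λ * (J * Jᴴ) * Λ' * Matrix.diagonal (fun i => (l i : ℂ))) * star V := by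
          rw [hVV]
          simp only [Matrix.mul_assoc, mul_one]
      _ = σ := by
          conv_rhs => rw [hspec]
          rw [hJJ, hΛ, hΛ', Matrix.diagonal_mul_diagonal, Matrix.diagonal_mul_diagonal,
            Matrix.diagonal_mul_diagonal]
          congr 3
          funext i
          by_cases hi : l i = 0
          · simp [hi]
          · have : (Real.sqrt (l i) : ℂ) ≠ 0 :=
              Complex.ofReal_ne_zero.mpr (Real.sqrt_ne_zero'.mpr ((hl0 i).lt_of_ne' hi))
            simp [hi, this]

/-- A generalized inverse of `σ` recovers every purification of `σ`. -/
lemma mul_eq_self_of_mul_mul_conjTranspose {a r : Type*} [Fintype a] [DecidableEq a] [Fintype r]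
    {G : Matrix a a ℂ} {W : Matrix a r ℂ} (h : G * (W * Wᴴ) = W * Wᴴ) : G * W = W := by
  have : (G * W - W) * (G * W - W)ᴴ = 0 := by
    calc (G * W - W) * (G * W - W)ᴴ
        = (G * (W * Wᴴ) - W * Wᴴ) * Gᴴ - (G * (W * Wᴴ) - W * Wᴴ) := by
          simp only [Matrix.conjTranspose_sub, Matrix.conjTranspose_mul, Matrix.sub_mul,
            Matrix.mul_sub, Matrix.mul_assoc]
      _ = 0 := by simp [h]
  exact sub_eq_zero.mp (Matrix.self_mul_conjTranspose_eq_zero.mp this)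

/-- If `σ = L Lᴴ`, the Haar measure on the unitary group of `r` induces a probability measure on
purifications of `σ` that is invariant under unitaries acting on `r`. -/
lemma exists_invariant_probabilityMeasure {a r : Type*} [Fintype a] [DecidableEq a] [Fintype r]
    [DecidableEq r] (L : Matrix a r ℂ) (n : ℕ) :
    ∃ μ : Measure (a × r → ℂ), IsProbabilityMeasure μ ∧
      (∀ᵐ φ ∂μ, ptrace (outer φ) = L * Lᴴ) ∧
      (∀ v w, Integrable (fun φ => tensorPow (outer φ) n v w) μ) ∧
      ∀ g ∈ Matrix.unitaryGroup r ℂ,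
        μ.map (fun φ => Matrix.kroneckerMap (· * ·) (1 : Matrix a a ℂ) gᵀ *ᵥ φ) = μ := by
  have : CompactSpace (Matrix.unitaryGroup r ℂ) := by
    suffices h : IsCompact (Matrix.unitaryGroup r ℂ : Set (Matrix r r ℂ)) from
      isCompact_iff_compactSpace.mp h
    have hcl : IsClosed (Matrix.unitaryGroup r ℂ : Set (Matrix r r ℂ)) := by
      have : (Matrix.unitaryGroup r ℂ : Set (Matrix r r ℂ)) = {U | U * star U = 1} := by
        ext U
        exact Matrix.mem_unitaryGroup_iff
      rw [this]
      exact isClosed_eq (by fun_prop) continuous_const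
    refine (isCompact_univ_pi fun _ : r => isCompact_univ_pi fun _ : r =>
      isCompact_closedBall (0 : ℂ) 1).of_isClosed_subset hcl fun U hU i _ j _ => ?_
    rw [mem_closedBall_zero_iff]
    exact entry_norm_bound_of_unitary hU i j
  let : MeasurableSpace (Matrix.unitaryGroup r ℂ) := borel _
  have : BorelSpace (Matrix.unitaryGroup r ℂ) := ⟨rfl⟩
  set ν : Measure (Matrix.unitaryGroup r ℂ) := Measure.haarMeasure ⊤ with hν
  have : IsProbabilityMeasure ν := ⟨Measure.haarMeasure_self⟩
  set f : Matrix.unitaryGroup r ℂ → (a × r → ℂ) := fun U p => (L * star (U : Matrix r r ℂ)) p.1 p.2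
    with hf
  have hfc : Continuous f := by
    refine continuous_pi fun p => ?_
    have : Continuous fun U : Matrix.unitaryGroup r ℂ => L * star (U : Matrix r r ℂ) := by fun_prop
    exact this.matrix_elem p.1 p.2
  refine ⟨ν.map f, Measure.isProbabilityMeasure_map hfc.aemeasurable, ?_, fun v w => ?_,
    fun g hg => ?_⟩
  · have : ∀ U, ptrace (outer (f U)) = L * Lᴴ := by
      intro U
      have h1 : ptrace (outer (f U)) =
          (L * star (U : Matrix r r ℂ)) * (L * star (U : Matrix r r ℂ))ᴴ := by
        ext x y
        rw [Matrix.mul_apply]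
        rfl
      rw [h1, Matrix.conjTranspose_mul, Matrix.star_eq_conjTranspose,
        Matrix.conjTranspose_conjTranspose, Matrix.mul_assoc, ← Matrix.mul_assoc _ _ Lᴴ,
        ← Matrix.star_eq_conjTranspose, Unitary.coe_star_mul_self, Matrix.one_mul]
    rw [ae_map_iff hfc.aemeasurable]
    · exact Filter.Eventually.of_forall this
    · refine IsClosed.measurableSet (isClosed_eq ?_ continuous_const)
      refine continuous_matrix fun x y => ?_
      simp only [ptrace, outer, Matrix.of_apply]
      fun_prop
  · have hc : Continuous fun φ : a × r → ℂ => tensorPow (outer φ) n v w := by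
      simp only [tensorPow, outer, Matrix.of_apply]
      fun_prop
    rw [integrable_map_measure hc.aestronglyMeasurable hfc.aemeasurable]
    exact (hc.comp hfc).integrable_of_hasCompactSupport (HasCompactSupport.of_compactSpace _)
  · have hk : Measurable fun φ : a × r → ℂ =>
        Matrix.kroneckerMap (· * ·) (1 : Matrix a a ℂ) gᵀ *ᵥ φ :=
      (Continuous.matrix_mulVec continuous_const continuous_id).measurable
    have hcomp : (fun φ : a × r → ℂ => Matrix.kroneckerMap (· * ·) (1 : Matrix a a ℂ) gᵀ *ᵥ φ) ∘ f
        = f ∘ fun U => (⟨g, hg⟩ : Matrix.unitaryGroup r ℂ)⁻¹ * U := by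
      funext U
      funext p
      have : f ((⟨g, hg⟩ : Matrix.unitaryGroup r ℂ)⁻¹ * U) p =
          (L * star (U : Matrix r r ℂ) * g) p.1 p.2 := by
        simp [hf, Matrix.mul_assoc]
      rw [Function.comp_apply, Function.comp_apply, this, Matrix.mul_apply]
      simp [Matrix.mulVec, dotProduct, Fintype.sum_prod_type, hf, Matrix.one_apply, mul_comm]
    rw [Measure.map_map hk hfc.measurable, hcomp, ← Measure.map_map hfc.measurable
      (measurable_const_mul _), map_mul_left_eq_self]

section Reshape

variable {a r : Type*} {n : ℕ}

/-- A vector on `n` copies of `a × r`, viewed as a matrix from `n` copies of `r` to `n` copies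
of `a`. -/
def reshape (x : (Fin n → a × r) → ℂ) : Matrix (Fin n → a) (Fin n → r) ℂ :=
  Matrix.of fun u z => x fun i => (u i, z i)

/-- The inverse of `reshape`. -/
def unshape (X : Matrix (Fin n → a) (Fin n → r) ℂ) : (Fin n → a × r) → ℂ :=
  fun v => X (fun i => (v i).1) (fun i => (v i).2)

lemma sum_eq_sum_sum_reshape [Fintype a] [DecidableEq a] [Fintype r] [DecidableEq r]
    (x : (Fin n → a × r) → ℂ) : ∑ v, x v = ∑ u, ∑ z, reshape x u z := by
  rw [← Fintype.sum_prod_type' fun u z => reshape x u z]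
  exact Fintype.sum_equiv (Equiv.arrowProdEquivProdArrow (Fin n) (fun _ => a) (fun _ => r))
    _ _ fun v => rfl

lemma ptraceN_outer [Fintype r] [DecidableEq r] (x : (Fin n → a × r) → ℂ) :
    ptraceN (outer x) = reshape x * (reshape x)ᴴ := by
  ext u u'
  rw [Matrix.mul_apply]
  rfl

lemma star_dotProduct_unshape [Fintype a] [DecidableEq a] [Fintype r] [DecidableEq r]
    (x : (Fin n → a × r) → ℂ) (Z : Matrix (Fin n → a) (Fin n → r) ℂ) :
    star x ⬝ᵥ unshape Z = (Z * (reshape x)ᴴ).trace := by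
  rw [dotProduct, sum_eq_sum_sum_reshape, Matrix.trace]
  refine Finset.sum_congr rfl fun u _ => ?_
  rw [Matrix.diag_apply, Matrix.mul_apply]
  exact Finset.sum_congr rfl fun z _ => mul_comm _ _

/-- The action of `g` on every copy of `r`. -/
lemma rectTensorPow_kronecker_mulVec [Fintype a] [DecidableEq a] [Fintype r] [DecidableEq r]
    (g : Matrix r r ℂ) (x : (Fin n → a × r) → ℂ) :
    rectTensorPow (Matrix.kroneckerMap (· * ·) (1 : Matrix a a ℂ) gᵀ) n *ᵥ x =
      unshape (reshape x * rectTensorPow g n) := by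
  funext v
  rw [Matrix.mulVec, dotProduct, sum_eq_sum_sum_reshape, unshape, Matrix.mul_apply]
  rw [Finset.sum_eq_single fun i => (v i).1]
  · refine Finset.sum_congr rfl fun z _ => ?_
    simp [reshape, rectTensorPow_apply, mul_comm]
  · intro u _ hu
    obtain ⟨i, hi⟩ := Function.ne_iff.mp hu
    refine Finset.sum_eq_zero fun z _ => ?_
    simp only [reshape, Matrix.of_apply, rectTensorPow_apply]
    rw [Finset.prod_eq_zero (Finset.mem_univ i), zero_mul]
    simp [Matrix.one_apply_ne' hi]
  · simp

/-- Right multiplication of a fixed matrix, as a linear map. -/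
def unshapeMulLeft [Fintype r] [DecidableEq r] (X : Matrix (Fin n → a) (Fin n → r) ℂ) :
    Matrix (Fin n → r) (Fin n → r) ℂ →ₗ[ℂ] ((Fin n → a × r) → ℂ) where
  toFun M := unshape (X * M)
  map_add' M N := by
    rw [Matrix.mul_add]
    rfl
  map_smul' c M := by
    rw [Matrix.mul_smul]
    rfl

lemma reshape_unshape (X : Matrix (Fin n → a) (Fin n → r) ℂ) : reshape (unshape X) = X := rfl

lemma unshapeMulLeft_reshape [Fintype a] [DecidableEq a] [Fintype r] [DecidableEq r]
    (x : (Fin n → a × r) → ℂ) (g : Matrix r r ℂ) :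
    unshapeMulLeft (reshape x) (rectTensorPow g n) =
      rectTensorPow (Matrix.kroneckerMap (· * ·) (1 : Matrix a a ℂ) gᵀ) n *ᵥ x :=
  (rectTensorPow_kronecker_mulVec g x).symm

end Reshape

lemma linearMap_eq_of_unitary {d ι : Type*} [Fintype d] [DecidableEq d] {n : ℕ}
    {f g : Matrix (Fin n → d) (Fin n → d) ℂ →ₗ[ℂ] (ι → ℂ)}
    (h : ∀ U ∈ Matrix.unitaryGroup d ℂ, f (rectTensorPow U n) = g (rectTensorPow U n))
    {N : Matrix (Fin n → d) (Fin n → d) ℂ}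
    (hN : ∀ (π : Equiv.Perm (Fin n)) v w, N (v ∘ π) (w ∘ π) = N v w) : f N = g N := by
  funext k
  have hexp : ∀ M, f M k - g M k =
      ∑ v, ∑ w, (f (Matrix.single v w 1) k - g (Matrix.single v w 1) k) * M v w := by
    intro M
    conv_lhs => rw [Matrix.matrix_eq_sum_single M]
    simp only [map_sum, Finset.sum_apply, ← Finset.sum_sub_distrib]
    refine Finset.sum_congr rfl fun v _ => Finset.sum_congr rfl fun w _ => ?_
    have : Matrix.single v w (M v w) = M v w • Matrix.single v w (1 : ℂ) := by
      simp [Matrix.smul_single]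
    rw [this, map_smul, map_smul, Pi.smul_apply, Pi.smul_apply, smul_eq_mul, smul_eq_mul]
    ring
  rw [← sub_eq_zero, hexp]
  refine sum_mul_eq_zero_of_unitary _ (fun U hU => ?_) N hN
  rw [← hexp, h U hU, sub_self]

/-- The quadratic form of a matrix commuting with local unitaries on the purifying systems takes
the same value on all symmetric purifications of `σ^⊗n`. -/
lemma dotProduct_mulVec_eq_trace {a r : Type*} [Fintype a] [DecidableEq a] [Fintype r]
    [DecidableEq r] {n : ℕ} {R : Matrix (Fin n → a × r) (Fin n → a × r) ℂ}
    (hR : ∀ g ∈ Matrix.unitaryGroup r ℂ,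
      Commute R (rectTensorPow (Matrix.kroneckerMap (· * ·) (1 : Matrix a a ℂ) gᵀ) n))
    {σ : Matrix a a ℂ} {L : Matrix a r ℂ} {Q : Matrix r a ℂ} (hLQ : L * Q * σ = σ)
    {x : (Fin n → a × r) → ℂ} (hx : SymmetricVec x)
    (hxσ : reshape x * (reshape x)ᴴ = rectTensorPow σ n) :
    star x ⬝ᵥ (R *ᵥ x) = (reshape (R *ᵥ unshape (rectTensorPow L n)) *
      (rectTensorPow Q n * rectTensorPow σ n)).trace := by
  set X := rectTensorPow L n with hX
  set M := rectTensorPow Q n * reshape x with hM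
  have hxM : unshape (X * M) = x := by
    have : X * M = reshape x := by
      rw [hM, hX, ← Matrix.mul_assoc, ← rectTensorPow_mul]
      refine mul_eq_self_of_mul_mul_conjTranspose ?_
      rw [hxσ, ← rectTensorPow_mul, hLQ]
    rw [this]
    rfl
  have hMsym : ∀ (π : Equiv.Perm (Fin n)) v w, M (v ∘ π) (w ∘ π) = M v w := by
    intro π v w
    simp only [hM, Matrix.mul_apply]
    rw [← Equiv.sum_comp (Equiv.arrowCongr π (Equiv.refl a)).symm]
    refine Finset.sum_congr rfl fun u _ => ?_
    congr 1
    · simp only [rectTensorPow_apply]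
      exact Equiv.prod_comp π fun i => Q (v i) (u i)
    · exact hx π fun i => (u i, w i)
  have hlin : (R.mulVecLin ∘ₗ unshapeMulLeft X) M = unshapeMulLeft (reshape (R *ᵥ unshape X)) M := by
    refine linearMap_eq_of_unitary (fun U hU => ?_) hMsym
    rw [LinearMap.comp_apply, Matrix.mulVecLin_apply, ← reshape_unshape X,
      unshapeMulLeft_reshape, unshapeMulLeft_reshape, reshape_unshape, Matrix.mulVec_mulVec,
      Matrix.mulVec_mulVec, (hR U hU).eq]
  have hRx : R *ᵥ x = unshape (reshape (R *ᵥ unshape X) * M) := by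
    conv_lhs => rw [← hxM]
    exact hlin
  rw [hRx, star_dotProduct_unshape, hM, ← hxσ]
  simp only [Matrix.mul_assoc]

lemma outer_eq_vecMulVec {d : Type*} (ψ : d → ℂ) : outer ψ = Matrix.vecMulVec ψ (star ψ) := rfl

lemma outer_mulVec {d : Type*} [Fintype d] (K : Matrix d d ℂ) (ψ : d → ℂ) :
    outer (K *ᵥ ψ) = K * outer ψ * Kᴴ := by
  rw [outer_eq_vecMulVec, outer_eq_vecMulVec, Matrix.star_mulVec, Matrix.mul_vecMulVec,
    Matrix.vecMulVec_mul]

/-- The `n`-fold tensor power of a vector. -/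
def vecTensorPow {d : Type*} (φ : d → ℂ) (n : ℕ) : (Fin n → d) → ℂ := fun v => ∏ i, φ (v i)

lemma symmetricVec_vecTensorPow {d : Type*} (φ : d → ℂ) (n : ℕ) :
    SymmetricVec (vecTensorPow φ n) :=
  fun π v => Equiv.prod_comp π fun i => φ (v i)

lemma tensorPow_outer {d : Type*} [Fintype d] (φ : d → ℂ) (n : ℕ) :
    tensorPow (outer φ) n = outer (vecTensorPow φ n) := by
  ext v w
  simp [tensorPow, outer, vecTensorPow, Finset.prod_mul_distrib]

lemma reshape_vecTensorPow_mul_conjTranspose {a r : Type*} [Fintype r] [DecidableEq r]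
    (φ : a × r → ℂ) (n : ℕ) :
    reshape (vecTensorPow φ n) * (reshape (vecTensorPow φ n))ᴴ =
      rectTensorPow (ptrace (outer φ)) n := by
  have h : ptrace (outer φ) = (Matrix.of fun x z => φ (x, z)) *
      (Matrix.of fun x z => φ (x, z))ᴴ := by
    ext x y
    rw [Matrix.mul_apply]
    rfl
  rw [h, rectTensorPow_mul, ← rectTensorPow_conjTranspose]
  rfl

section Moment

variable {e : Type*} [Fintype e] {n : ℕ} {μ : Measure (e → ℂ)}

/-- The moment matrix `∫ |φ⟩⟨φ|^⊗n dμ(φ)`. -/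
def momentMatrix (μ : Measure (e → ℂ)) (n : ℕ) : Matrix (Fin n → e) (Fin n → e) ℂ :=
  Matrix.of fun v w => ∫ φ, tensorPow (outer φ) n v w ∂μ

variable (hμ : ∀ v w, Integrable (fun φ => tensorPow (outer φ) n v w) μ)

include hμ

lemma integrable_mul_tensorPow_mul {k l : Type*} [DecidableEq e]
    (A : Matrix k (Fin n → e) ℂ) (B : Matrix (Fin n → e) l ℂ) (v : k) (w : l) :
    Integrable (fun φ => (A * tensorPow (outer φ) n * B) v w) μ := by
  simp only [Matrix.mul_apply]
  exact integrable_finsetSum _ fun y _ =>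
    (integrable_finsetSum _ fun x _ => (hμ x y).const_mul _).mul_const _

lemma mul_momentMatrix_mul_apply {k l : Type*} [DecidableEq e]
    (A : Matrix k (Fin n → e) ℂ) (B : Matrix (Fin n → e) l ℂ) (v : k) (w : l) :
    (A * momentMatrix μ n * B) v w = ∫ φ, (A * tensorPow (outer φ) n * B) v w ∂μ := by
  simp only [Matrix.mul_apply]
  rw [integral_finsetSum _ fun y _ =>
    (integrable_finsetSum _ fun x _ => (hμ x y).const_mul _).mul_const _]
  refine Finset.sum_congr rfl fun y _ => ?_
  rw [integral_mul_const, integral_finsetSum _ fun x _ => (hμ x y).const_mul _]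
  congr 1
  refine Finset.sum_congr rfl fun x _ => ?_
  rw [integral_const_mul]
  rfl

lemma trace_mul_momentMatrix [DecidableEq e] (A : Matrix (Fin n → e) (Fin n → e) ℂ) :
    (A * momentMatrix μ n).trace = ∫ φ, (A * tensorPow (outer φ) n).trace ∂μ := by
  have h1 := mul_momentMatrix_mul_apply hμ A (1 : Matrix (Fin n → e) (Fin n → e) ℂ)
  have h2 := integrable_mul_tensorPow_mul hμ A (1 : Matrix (Fin n → e) (Fin n → e) ℂ)
  simp only [Matrix.mul_one] at h1 h2
  simp only [Matrix.trace, Matrix.diag_apply, h1]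
  rw [integral_finsetSum _ fun v _ => h2 v v]

lemma posSemidef_momentMatrix [DecidableEq e] : (momentMatrix μ n).PosSemidef := by
  refine Matrix.PosSemidef.of_dotProduct_mulVec_nonneg ?_ fun x => ?_
  · ext v w
    rw [Matrix.conjTranspose_apply]
    simp only [momentMatrix, Matrix.of_apply]
    rw [← starRingEnd_apply, ← integral_conj]
    refine integral_congr_ae (Filter.Eventually.of_forall fun φ => ?_)
    simp [tensorPow, outer, mul_comm]
  · have h1 : star x ⬝ᵥ (momentMatrix μ n *ᵥ x) =
        (Matrix.vecMulVec x (star x) * momentMatrix μ n).trace := by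
      rw [Matrix.dotProduct_mulVec, Matrix.vecMulVec_mul, Matrix.trace_vecMulVec,
        dotProduct_comm]
    rw [h1, trace_mul_momentMatrix hμ]
    refine integral_nonneg fun φ => ?_
    rw [Matrix.trace_mul_comm, tensorPow_outer, outer_eq_vecMulVec]
    exact trace_mul_vecMulVec_star_nonneg (Matrix.posSemidef_vecMulVec_self_star _) x

lemma commute_momentMatrix [DecidableEq e] {K : Matrix e e ℂ} (hK : Kᴴ * K = 1)
    (hinv : μ.map (fun φ => K *ᵥ φ) = μ) : Commute (momentMatrix μ n) (rectTensorPow K n) := by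
  have h1 : rectTensorPow K n * momentMatrix μ n * (rectTensorPow K n)ᴴ = momentMatrix μ n := by
    ext v w
    have hc : Continuous fun φ : e → ℂ => tensorPow (outer φ) n v w := by
      simp only [tensorPow, outer, Matrix.of_apply]
      fun_prop
    have hk : Continuous fun φ : e → ℂ => K *ᵥ φ :=
      Continuous.matrix_mulVec continuous_const continuous_id
    rw [mul_momentMatrix_mul_apply hμ]
    conv_rhs => rw [momentMatrix, Matrix.of_apply, ← hinv,
      integral_map hk.aemeasurable hc.aestronglyMeasurable]
    refine integral_congr_ae (Filter.Eventually.of_forall fun φ => ?_)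
    simp only [outer_mulVec]
    rw [rectTensorPow_conjTranspose]
    change (rectTensorPow K n * rectTensorPow (outer φ) n * rectTensorPow Kᴴ n) v w =
      rectTensorPow (K * outer φ * Kᴴ) n v w
    rw [rectTensorPow_mul, rectTensorPow_mul]
  have h2 : (rectTensorPow K n)ᴴ * rectTensorPow K n = 1 := by
    rw [rectTensorPow_conjTranspose, ← rectTensorPow_mul, hK, ← Matrix.diagonal_one,
      rectTensorPow_diagonal]
    simp
  calc momentMatrix μ n * rectTensorPow K n
      = rectTensorPow K n * momentMatrix μ n * ((rectTensorPow K n)ᴴ * rectTensorPow K n) := by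
        conv_lhs => rw [← h1]
        simp only [Matrix.mul_assoc]
    _ = rectTensorPow K n * momentMatrix μ n := by rw [h2, Matrix.mul_one]

end Moment

/-- Every symmetric purification of `σ^⊗n` is dominated by the moment matrix of an invariant
measure on purifications of `σ`. -/
lemma posSemidef_choose_smul_momentMatrix_sub_outer {a r : Type*} [Fintype a] [DecidableEq a]
    [Fintype r] [DecidableEq r] {n : ℕ} {μ : Measure (a × r → ℂ)} [IsProbabilityMeasure μ]
    {σ : Matrix a a ℂ} {L : Matrix a r ℂ} {Q : Matrix r a ℂ} (hLQ : L * Q * σ = σ)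
    (hμσ : ∀ᵐ φ ∂μ, ptrace (outer φ) = σ)
    (hμ : ∀ v w, Integrable (fun φ => tensorPow (outer φ) n v w) μ)
    (hinv : ∀ g ∈ Matrix.unitaryGroup r ℂ,
      μ.map (fun φ => Matrix.kroneckerMap (· * ·) (1 : Matrix a a ℂ) gᵀ *ᵥ φ) = μ)
    (hpos : 0 < (n + Fintype.card (a × r) - 1).choose n)
    {Ψ : (Fin n → a × r) → ℂ} (hΨ : SymmetricVec Ψ)
    (hΨσ : reshape Ψ * (reshape Ψ)ᴴ = rectTensorPow σ n) :
    (((n + Fintype.card (a × r) - 1).choose n : ℂ) • momentMatrix μ n - outer Ψ).PosSemidef := by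
  set T := momentMatrix μ n with hT
  set N := (n + Fintype.card (a × r) - 1).choose n with hN
  refine posSemidef_of_forall_add_smul_one (g := (N : ℝ)) fun ε hε => ?_
  set S := T + (ε : ℂ) • (1 : Matrix (Fin n → a × r) (Fin n → a × r) ℂ) with hS
  have hSpos : S.PosDef :=
    (Matrix.PosDef.one.smul (by exact_mod_cast hε : (0 : ℂ) < ε)).posSemidef_add
      (posSemidef_momentMatrix hμ)
  have hSunit : IsUnit S.det := (Matrix.isUnit_iff_isUnit_det S).mp hSpos.isUnit
  have hcomm : ∀ g ∈ Matrix.unitaryGroup r ℂ,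
      Commute S⁻¹ (rectTensorPow (Matrix.kroneckerMap (· * ·) (1 : Matrix a a ℂ) gᵀ) n) := by
    intro g hg
    set K := Matrix.kroneckerMap (· * ·) (1 : Matrix a a ℂ) gᵀ with hK
    have hKK : Kᴴ * K = 1 := by
      have hg' : gᵀᴴ * gᵀ = 1 := by
        have hconj : gᵀᴴ = gᴴᵀ := rfl
        rw [hconj, ← Matrix.transpose_mul, ← Matrix.star_eq_conjTranspose,
          Matrix.mem_unitaryGroup_iff.mp hg, Matrix.transpose_one]
      rw [hK, Matrix.conjTranspose_kronecker, ← Matrix.mul_kronecker_mul, hg']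
      simp
    have h1 : Commute S (rectTensorPow K n) :=
      (commute_momentMatrix hμ hKK (hinv g hg)).add_left ((Commute.one_left _).smul_left _)
    calc S⁻¹ * rectTensorPow K n
        = S⁻¹ * (rectTensorPow K n * S) * S⁻¹ := by
          rw [Matrix.mul_assoc, Matrix.mul_assoc, Matrix.mul_nonsing_inv S hSunit, Matrix.mul_one]
      _ = S⁻¹ * S * (rectTensorPow K n * S⁻¹) := by
          rw [← h1.eq]
          simp only [Matrix.mul_assoc]
      _ = rectTensorPow K n * S⁻¹ := by rw [Matrix.nonsing_inv_mul S hSunit, Matrix.one_mul]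
  have hconst := fun x hx hxσ => dotProduct_mulVec_eq_trace (n := n) (x := x) hcomm hLQ hx hxσ
  set c := (reshape (S⁻¹ *ᵥ unshape (rectTensorPow L n)) *
      (rectTensorPow Q n * rectTensorPow σ n)).trace with hc
  have hST : S⁻¹ * T = 1 - (ε : ℂ) • S⁻¹ := by
    rw [eq_sub_iff_add_eq, ← Matrix.nonsing_inv_mul S hSunit]
    conv_rhs => rw [hS, Matrix.mul_add, Matrix.mul_smul, Matrix.mul_one]
  have htrace : (S⁻¹ * T).trace = c := by
    rw [hT, trace_mul_momentMatrix hμ]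
    have : ∀ᵐ φ ∂μ, (S⁻¹ * tensorPow (outer φ) n).trace = c := by
      filter_upwards [hμσ] with φ hφ
      rw [tensorPow_outer, outer_eq_vecMulVec, Matrix.mul_vecMulVec, Matrix.trace_vecMulVec,
        dotProduct_comm]
      refine hconst _ (symmetricVec_vecTensorPow φ n) ?_
      rw [reshape_vecTensorPow_mul_conjTranspose, hφ]
    rw [integral_congr_ae this]
    simp
  have hTsymm : ∀ (π : Equiv.Perm (Fin n)) v w, T v (w ∘ π) = T v w := by
    intro π v w
    refine integral_congr_ae (Filter.Eventually.of_forall fun φ => ?_)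
    change tensorPow (outer φ) n v (w ∘ π) = tensorPow (outer φ) n v w
    rw [tensorPow_outer]
    simp only [outer, Matrix.of_apply, symmetricVec_vecTensorPow φ n π w]
  have hle : c ≤ (N : ℂ) :=
    htrace ▸ trace_mul_le_choose hε.le hTsymm hSpos.inv.posSemidef hST
  have hmain := posSemidef_smul_sub_vecMulVec hSpos (x := Ψ) (g := (N : ℝ))
    (by exact_mod_cast hpos) (by simpa [hconst Ψ hΨ hΨσ] using hle)
  convert hmain using 1
  rw [hS, outer_eq_vecMulVec, smul_add, smul_smul]
  push_cast
  abel

/-- **Theorem 2.1 (de Finetti reduction with fixed marginal).** -/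
theorem deFinetti_fixed_marginal (n dA dR : ℕ) (hn : 0 < n) (hdA : 0 < dA) (hdR : 0 < dR)
    (σhat : Matrix (Fin dA) (Fin dA) ℂ) (hσ : σhat.PosSemidef)
    (Ψ : (Fin n → Fin dA × Fin dR) → ℂ) (hsym : SymmetricVec Ψ)
    (hmarg : ptraceN (outer Ψ) = tensorPow σhat n) :
    ∃ μ : Measure ((Fin dA × Fin dR) → ℂ), IsProbabilityMeasure μ ∧
      (∀ᵐ φ ∂μ, ptrace (outer φ) = σhat) ∧
      (∀ v w, Integrable (fun φ => tensorPow (outer φ) n v w) μ) ∧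
      (((n + dA * dR - 1).choose n : ℂ) •
          (Matrix.of fun v w => ∫ φ, tensorPow (outer φ) n v w ∂μ) - outer Ψ).PosSemidef := by
  have hΨσ : reshape Ψ * (reshape Ψ)ᴴ = rectTensorPow σhat n := by
    rw [← ptraceN_outer, hmarg]
    rfl
  obtain ⟨L, Q, hL, hLQ⟩ := exists_factorization hn.ne' hσ hΨσ
  obtain ⟨μ, hprob, hμσ, hμ, hinv⟩ := exists_invariant_probabilityMeasure L n
  rw [hL] at hμσ
  refine ⟨μ, hprob, hμσ, hμ, ?_⟩
  have hcard : Fintype.card (Fin dA × Fin dR) = dA * dR := by simp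
  have hpos : 0 < (n + Fintype.card (Fin dA × Fin dR) - 1).choose n := by
    have := Nat.mul_pos hdA hdR
    exact Nat.choose_pos (by omega)
  have := posSemidef_choose_smul_momentMatrix_sub_outer hLQ hμσ hμ hinv hpos hsym hΨσ
  rwa [hcard] at this

end
end

section
/- (Theorem 2.4, de Finetti reduction with symmetries and fixed marginal) Let n, k be positive natural numbers and a, r : Fin k → ℕ. Set α := Σ i : Fin k, Fin (a i) and β := Σ i : Fin k, Fin (r i). Call a vector φ : α × β → ℂ block-compatible if φ (x, y) = 0 whenever x.1 ≠ y.1. Let σ̂ be a positive semidefinite matrix indexed by α, and let Ψ : (Fin n → α × β) → ℂ be a symmetric vector such that Ψ v = 0 unless ((v j).1).1 = ((v j).2).1 for every j : Fin n, and such that the partial trace over the β-systems of |Ψ⟩⟨Ψ| equals σ̂^⊗n. Then there exists a probability measure μ on the space of vectors φ : α × β → ℂ (Borel σ-algebra) such that: μ-almost every φ is a block-compatible purification of σ̂ with purifying system β; every entry of φ ↦ |φ⟩⟨φ|^⊗n is μ-integrable; and g_{n, x} • T − |Ψ⟩⟨Ψ| is positive semidefinite with x = ∑ i, (a i) * (r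 i), where T has entries T v w = ∫ (|φ⟩⟨φ|^⊗n) v w dμ(φ). -/
open MeasureTheory
open scoped ComplexOrder

noncomputable section

/-- A vector on a block-structured bipartite space is block-compatible if it vanishes
on pairs of indices belonging to different blocks. -/
def BlockCompatible {k : ℕ} {a r : Fin k → ℕ}
    (φ : (Σ i : Fin k, Fin (a i)) × (Σ i : Fin k, Fin (r i)) → ℂ) : Prop :=
  ∀ x : Σ i : Fin k, Fin (a i), ∀ y : Σ i : Fin k, Fin (r i), x.1 ≠ y.1 → φ (x, y) = 0

namespace DeFinetti

open scoped Kronecker Matrix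

set_option linter.unusedSectionVars false

/-- `n`-fold tensor power of a rectangular matrix. -/
def tpow {m p : Type*} (n : ℕ) (M : Matrix m p ℂ) : Matrix (Fin n → m) (Fin n → p) ℂ :=
  Matrix.of fun v w => ∏ i, M (v i) (w i)

/-- A matrix whose entries vanish on pairs of indices with different labels. -/
def IsBlock {m p κ : Type*} (f : m → κ) (g : p → κ) (M : Matrix m p ℂ) : Prop :=
  ∀ x y, f x ≠ g y → M x y = 0

section Basics

variable {m p q κ : Type*} {n : ℕ}

theorem tpow_apply (M : Matrix m p ℂ) (v : Fin n → m) (w : Fin n → p) :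
    tpow n M v w = ∏ i, M (v i) (w i) := rfl

theorem tpow_mul [Fintype p] [DecidableEq p] (M : Matrix m p ℂ) (N : Matrix p q ℂ) :
    tpow n (M * N) = tpow n M * tpow n N := by
  ext v w
  simp only [tpow_apply, Matrix.mul_apply, Finset.prod_univ_sum, Fintype.piFinset_univ,
    Finset.prod_mul_distrib]

theorem tpow_conjTranspose (M : Matrix m p ℂ) : tpow n Mᴴ = (tpow n M)ᴴ := by
  ext v w
  simp [tpow_apply, Matrix.conjTranspose_apply]

theorem tpow_transpose (M : Matrix m p ℂ) : tpow n Mᵀ = (tpow n M)ᵀ := by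
  ext v w
  simp [tpow_apply]

theorem tpow_diagonal [DecidableEq m] (d : m → ℂ) :
    tpow n (Matrix.diagonal d) = Matrix.diagonal fun v => ∏ i, d (v i) := by
  ext v w
  rw [tpow_apply, Matrix.diagonal_apply]
  split_ifs with h
  · subst h; simp
  · obtain ⟨i, hi⟩ := Function.ne_iff.mp h
    exact Finset.prod_eq_zero (Finset.mem_univ i) (Matrix.diagonal_apply_ne _ hi)

theorem tpow_one [DecidableEq m] : tpow n (1 : Matrix m m ℂ) = 1 := by
  rw [← Matrix.diagonal_one, tpow_diagonal]
  simp

theorem tpow_comp_perm (M : Matrix m p ℂ) (π : Equiv.Perm (Fin n)) (v : Fin n → m)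
    (w : Fin n → p) : tpow n M (v ∘ π) (w ∘ π) = tpow n M v w := by
  simp only [tpow_apply, Function.comp_apply]
  exact Equiv.prod_comp π fun i => M (v i) (w i)

theorem IsBlock.mul [Fintype p] {f : m → κ} {g : p → κ} {h : q → κ} {M : Matrix m p ℂ}
    {N : Matrix p q ℂ} (hM : IsBlock f g M) (hN : IsBlock g h N) : IsBlock f h (M * N) := by
  intro x y hxy
  rw [Matrix.mul_apply]
  refine Finset.sum_eq_zero fun z _ => ?_
  by_cases hz : f x = g z
  · rw [hN z y (hz ▸ hxy), mul_zero]
  · rw [hM x z hz, zero_mul]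

theorem IsBlock.conjTranspose {f : m → κ} {g : p → κ} {M : Matrix m p ℂ}
    (hM : IsBlock f g M) : IsBlock g f Mᴴ := by
  intro x y hxy
  rw [Matrix.conjTranspose_apply, hM y x hxy.symm, star_zero]

theorem IsBlock.transpose {f : m → κ} {g : p → κ} {M : Matrix m p ℂ}
    (hM : IsBlock f g M) : IsBlock g f Mᵀ := by
  intro x y hxy
  rw [Matrix.transpose_apply, hM y x hxy.symm]

theorem IsBlock.add {f : m → κ} {g : p → κ} {M N : Matrix m p ℂ}
    (hM : IsBlock f g M) (hN : IsBlock f g N) : IsBlock f g (M + N) := by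
  intro x y hxy
  rw [Matrix.add_apply, hM x y hxy, hN x y hxy, add_zero]

theorem IsBlock.smul {f : m → κ} {g : p → κ} {M : Matrix m p ℂ} (c : ℂ)
    (hM : IsBlock f g M) : IsBlock f g (c • M) := by
  intro x y hxy
  rw [Matrix.smul_apply, hM x y hxy, smul_zero]

theorem IsBlock.diagonal [DecidableEq m] (f : m → κ) (d : m → ℂ) :
    IsBlock f f (Matrix.diagonal d) :=
  fun _ _ hxy => Matrix.diagonal_apply_ne _ fun h => hxy (congrArg f h)

theorem IsBlock.tpow {f : m → κ} {g : p → κ} {M : Matrix m p ℂ} (hM : IsBlock f g M) :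
    IsBlock (fun v : Fin n → m => f ∘ v) (fun w : Fin n → p => g ∘ w) (tpow n M) := by
  intro v w hvw
  obtain ⟨i, hi⟩ := Function.ne_iff.mp hvw
  exact Finset.prod_eq_zero (Finset.mem_univ i) (hM _ _ hi)

end Basics

/-- A compact convex set of matrices that is stable under conjugation by a family of unitaries
contains an element commuting with all of them. -/
theorem exists_mem_forall_commute {ι : Type*} [Fintype ι] [DecidableEq ι]
    {C : Set (Matrix ι ι ℂ)} (hC : IsCompact C) (hconv : Convex ℝ C) (hne : C.Nonempty)
    {Γ : Set (Matrix ι ι ℂ)} (hΓ : ∀ U ∈ Γ, Uᴴ * U = 1)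
    (hinv : ∀ U ∈ Γ, ∀ X ∈ C, U * X * Uᴴ ∈ C) : ∃ T ∈ C, ∀ U ∈ Γ, Commute T U := by
  let f : Matrix ι ι ℂ → ℝ := fun X => (X * Xᴴ).trace.re
  have hf : Continuous f := by fun_prop
  obtain ⟨T, hT, hmin⟩ := hC.exists_isMinOn hne hf.continuousOn
  refine ⟨T, hT, fun U hU => ?_⟩
  have hUU := hΓ U hU
  set Y := U * T * Uᴴ with hY
  have hYC : Y ∈ C := hinv U hU T hT
  have hfY : f Y = f T := by
    have : Y * Yᴴ = U * (T * Tᴴ) * Uᴴ := by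
      rw [hY]
      simp only [Matrix.conjTranspose_mul, Matrix.conjTranspose_conjTranspose]
      calc U * T * Uᴴ * (U * (Tᴴ * Uᴴ)) = U * T * (Uᴴ * U) * (Tᴴ * Uᴴ) := by
            simp only [Matrix.mul_assoc]
        _ = _ := by rw [hUU]; simp only [Matrix.mul_assoc, Matrix.one_mul]
    simp only [f]
    rw [this, Matrix.trace_mul_comm, ← Matrix.mul_assoc, hUU, Matrix.one_mul]
  have hmid : (1 / 2 : ℝ) • T + (1 / 2 : ℝ) • Y ∈ C :=
    hconv hT hYC (by norm_num) (by norm_num) (by norm_num)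
  have h1 : f T ≤ f ((1 / 2 : ℝ) • T + (1 / 2 : ℝ) • Y) := hmin hmid
  have h2 : f ((1 / 2 : ℝ) • T + (1 / 2 : ℝ) • Y) + f (T - Y) / 4 = (f T + f Y) / 2 := by
    simp only [f, Matrix.conjTranspose_add, Matrix.conjTranspose_sub, Matrix.conjTranspose_smul,
      Matrix.add_mul, Matrix.mul_add, Matrix.sub_mul, Matrix.mul_sub, Matrix.trace_add,
      Matrix.trace_sub, Matrix.smul_mul, Matrix.mul_smul, Matrix.trace_smul, star_trivial,
      Complex.add_re, Complex.sub_re, Complex.real_smul, Complex.re_ofReal_mul]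
    ring
  have h3 : ((T - Y) * (T - Y)ᴴ).trace.re ≤ 0 := by
    change f (T - Y) ≤ 0
    linarith
  have h4 := (Matrix.posSemidef_self_mul_conjTranspose (T - Y)).trace_nonneg
  have h5 : ((T - Y) * (T - Y)ᴴ).trace = 0 := by
    rw [Complex.le_def] at h4
    apply Complex.ext
    · exact le_antisymm h3 h4.1
    · exact h4.2.symm
  have h6 : T = Y := sub_eq_zero.mp (Matrix.trace_mul_conjTranspose_self_eq_zero_iff.mp h5)
  change T * U = U * T
  conv_lhs => rw [h6, hY, Matrix.mul_assoc, hUU, Matrix.mul_one]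

/-- The convex hull of a compact subset of a finite-dimensional space is compact. -/
theorem isCompact_convexHull {E : Type*} [AddCommGroup E] [Module ℝ E] [TopologicalSpace E]
    [IsTopologicalAddGroup E] [ContinuousSMul ℝ E] [FiniteDimensional ℝ E] {K : Set E}
    (hK : IsCompact K) : IsCompact (convexHull ℝ K) := by
  rcases K.eq_empty_or_nonempty with rfl | ⟨x₀, hx₀⟩
  · simp
  let N := Module.finrank ℝ E + 1
  let g : (Fin N → ℝ) × (Fin N → E) → E := fun q => ∑ i, q.1 i • q.2 i
  have hg : Continuous g := by fun_prop
  have hcomp : IsCompact (stdSimplex ℝ (Fin N) ×ˢ Set.univ.pi fun _ : Fin N => K) :=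
    (isCompact_stdSimplex ℝ (Fin N)).prod (isCompact_univ_pi fun _ => hK)
  suffices h : convexHull ℝ K =
      g '' (stdSimplex ℝ (Fin N) ×ˢ Set.univ.pi fun _ : Fin N => K) by
    rw [h]; exact hcomp.image hg
  apply Set.Subset.antisymm
  · intro x hx
    obtain ⟨ι, _, z, w, hz, hind, hw, hw1, rfl⟩ := eq_pos_convex_span_of_mem_convexHull hx
    have hcard : Fintype.card ι ≤ Fintype.card (Fin N) := by
      rw [Fintype.card_fin]
      exact hind.card_le_finrank_succ.trans
        (Nat.succ_le_succ (Submodule.finrank_le _))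
    obtain ⟨e⟩ := Function.Embedding.nonempty_of_card_le hcard
    refine ⟨(Function.extend e w 0, Function.extend e z fun _ => x₀), ⟨⟨?_, ?_⟩, ?_⟩, ?_⟩
    · intro j
      by_cases hj : ∃ i, e i = j
      · obtain ⟨i, rfl⟩ := hj
        simpa [e.injective.extend_apply] using (hw i).le
      · simp [Function.extend_apply' _ _ _ hj]
    · rw [← hw1]
      symm
      apply Fintype.sum_of_injective e e.injective
      · intro j hj
        exact Function.extend_apply' _ _ _ hj
      · intro i; simp [e.injective.extend_apply]
    · intro j _
      by_cases hj : ∃ i, e i = j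
      · obtain ⟨i, rfl⟩ := hj
        simpa [e.injective.extend_apply] using hz ⟨i, rfl⟩
      · simpa [Function.extend_apply' _ _ _ hj] using hx₀
    · symm
      apply Fintype.sum_of_injective e e.injective
      · intro j hj
        simp only
        rw [Function.extend_apply' _ _ _ hj]
        simp
      · intro i; simp [e.injective.extend_apply]
  · rintro _ ⟨⟨w, z⟩, ⟨⟨hw0, hw1⟩, hz⟩, rfl⟩
    exact (convex_convexHull ℝ K).sum_mem (fun i _ => hw0 i) hw1
      fun i _ => subset_convexHull ℝ K (hz i (Set.mem_univ i))

/-- Two tuples with the same multiplicities differ by a permutation of the positions. -/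
theorem exists_perm_comp_eq {D : Type*} [DecidableEq D] {n : ℕ} {v w : Fin n → D}
    (h : ∀ d, Fintype.card {i // v i = d} = Fintype.card {i // w i = d}) :
    ∃ π : Equiv.Perm (Fin n), w ∘ π = v :=
  ⟨Equiv.ofFiberEquiv fun d => Fintype.equivOfCardEq (h d),
    funext fun i => Equiv.ofFiberEquiv_map _ i⟩

/-- A linear functional vanishing on all product vectors `x ⊗ ⋯ ⊗ x` with `x` supported on `P`
vanishes on all symmetric vectors supported on tuples in `P`. -/
theorem linearMap_eq_zero_of_symmetric {D : Type*} [Fintype D] [DecidableEq D] {n : ℕ}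
    (P : D → Prop) (ℓ : ((Fin n → D) → ℂ) →ₗ[ℂ] ℂ)
    (h : ∀ x : D → ℂ, (∀ d, ¬ P d → x d = 0) → ℓ (fun v => ∏ i, x (v i)) = 0)
    (f : (Fin n → D) → ℂ) (hsym : ∀ (π : Equiv.Perm (Fin n)) v, f (v ∘ π) = f v)
    (hP : ∀ v, (∃ i, ¬ P (v i)) → f v = 0) : ℓ f = 0 := by
  classical
  have hℓ : ∀ g : (Fin n → D) → ℂ, ℓ g = ∑ v, g v * ℓ (Pi.single v 1) := by
    intro g
    conv_lhs => rw [pi_eq_sum_univ' g]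
    rw [map_sum]
    refine Finset.sum_congr rfl fun v _ => ?_
    rw [map_smul, smul_eq_mul]
  let occ : (Fin n → D) → (D →₀ ℕ) := fun v => ∑ i, Finsupp.single (v i) 1
  have occ_apply : ∀ v d, occ v d = Fintype.card {i // v i = d} := by
    intro v d
    simp only [occ, Finsupp.finsetSum_apply, Finsupp.single_apply, Fintype.card_subtype,
      Finset.card_filter]
  let c : (Fin n → D) → ℂ := fun v => if ∀ i, P (v i) then ℓ (Pi.single v 1) else 0
  let p : MvPolynomial D ℂ := ∑ v, MvPolynomial.monomial (occ v) (c v)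
  have hp : p = 0 := by
    apply MvPolynomial.funext
    intro x
    have h0 := h (fun d => if P d then x d else 0) (fun d hd => if_neg hd)
    rw [hℓ] at h0
    rw [map_zero, ← h0, map_sum]
    refine Finset.sum_congr rfl fun v _ => ?_
    have hmon : MvPolynomial.monomial (occ v) (c v) =
        MvPolynomial.C (c v) * ∏ i, MvPolynomial.X (v i) := by
      simp only [occ, MvPolynomial.monomial_sum_index, MvPolynomial.X]
    rw [hmon, map_mul, map_prod]
    simp only [MvPolynomial.eval_C, MvPolynomial.eval_X, c]
    split_ifs with hv
    · rw [mul_comm]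
      congr 1
      exact Finset.prod_congr rfl fun i _ => (if_pos (hv i)).symm
    · push Not at hv
      obtain ⟨i, hi⟩ := hv
      have h1 : (∏ j, if P (v j) then x (v j) else 0) = 0 :=
        Finset.prod_eq_zero (Finset.mem_univ i) (if_neg hi)
      rw [h1, zero_mul, zero_mul]
  have hF : ∃ F : (D →₀ ℕ) → ℂ, ∀ v, F (occ v) = f v := by
    have hfac : Function.FactorsThrough f occ := by
      intro v w hvw
      obtain ⟨π, rfl⟩ := exists_perm_comp_eq (v := v) (w := w) fun d => by
        rw [← occ_apply, ← occ_apply, hvw]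
      exact hsym π w
    exact ⟨Function.extend occ f 0, fun v => hfac.extend_apply 0 v⟩
  obtain ⟨F, hF⟩ := hF
  have hfc : ℓ f = ∑ v, F (occ v) * c v := by
    rw [hℓ]
    refine Finset.sum_congr rfl fun v _ => ?_
    rw [hF]
    by_cases hv : ∀ i, P (v i)
    · simp only [c, if_pos hv]
    · push Not at hv
      rw [hP v hv, zero_mul, zero_mul]
  have hcoeff : ∀ m, ∑ v with occ v = m, c v = 0 := by
    intro m
    have := congrArg (MvPolynomial.coeff m) hp
    simpa only [p, MvPolynomial.coeff_sum, MvPolynomial.coeff_monomial, MvPolynomial.coeff_zero,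
      ← Finset.sum_filter] using this
  rw [hfc, ← Finset.sum_fiberwise_of_maps_to (t := Finset.univ.image occ) (g := occ)
    (fun v _ => Finset.mem_image_of_mem _ (Finset.mem_univ v))]
  refine Finset.sum_eq_zero fun m _ => ?_
  rw [← mul_zero (F m), ← hcoeff m, Finset.mul_sum]
  refine Finset.sum_congr rfl fun v hv => ?_
  rw [(Finset.mem_filter.mp hv).2]

/-- Linear functionals of `(X + tY)^⊗n` are polynomial in `t`. -/
theorem linearMap_tpow_eq_zero_of_real {m p : Type*} [Fintype m] [Fintype p] [DecidableEq m]
    [DecidableEq p] {n : ℕ} (ℓ : Matrix (Fin n → m) (Fin n → p) ℂ →ₗ[ℂ] ℂ) (X Y : Matrix m p ℂ)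
    (h : ∀ t : ℝ, ℓ (tpow n (X + (t : ℂ) • Y)) = 0) (z : ℂ) : ℓ (tpow n (X + z • Y)) = 0 := by
  let q : Polynomial ℂ := ∑ v, ∑ w, Polynomial.C (ℓ (Matrix.single v w 1)) *
    ∏ i, (Polynomial.C (X (v i) (w i)) + Polynomial.X * Polynomial.C (Y (v i) (w i)))
  have hq : ∀ t : ℂ, q.eval t = ℓ (tpow n (X + t • Y)) := by
    intro t
    conv_rhs => rw [Matrix.matrix_eq_sum_single (tpow n (X + t • Y))]
    simp only [q, Polynomial.eval_finsetSum, map_sum, Polynomial.eval_mul, Polynomial.eval_prod,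
      Polynomial.eval_add, Polynomial.eval_C, Polynomial.eval_X]
    refine Finset.sum_congr rfl fun v _ => Finset.sum_congr rfl fun w _ => ?_
    rw [← mul_one (tpow n (X + t • Y) v w), ← smul_eq_mul (tpow n (X + t • Y) v w),
      ← Matrix.smul_single, map_smul, smul_eq_mul, mul_comm]
    simp [tpow_apply]
  have hq0 : q = 0 := by
    apply Polynomial.eq_zero_of_infinite_isRoot
    refine Set.Infinite.mono (s := Set.range ((↑) : ℝ → ℂ)) ?_
      (Set.infinite_range_of_injective Complex.ofReal_injective)
    rintro _ ⟨t, rfl⟩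
    change q.eval _ = 0
    rw [hq, h]
  rw [← hq, hq0, Polynomial.eval_zero]

/-- Block-diagonal Hermitian matrices are diagonalized by block-diagonal unitaries. -/
theorem exists_block_spectral {κ : Type*} [Fintype κ] [DecidableEq κ] {m : κ → Type*}
    [∀ i, Fintype (m i)] [∀ i, DecidableEq (m i)] {H : Matrix (Σ i, m i) (Σ i, m i) ℂ}
    (hH : H.IsHermitian) (hb : IsBlock Sigma.fst Sigma.fst H) :
    ∃ (W : Matrix (Σ i, m i) (Σ i, m i) ℂ) (d : (Σ i, m i) → ℝ),
      IsBlock Sigma.fst Sigma.fst W ∧ Wᴴ * W = 1 ∧ W * Wᴴ = 1 ∧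
        H = W * Matrix.diagonal (fun x => (d x : ℂ)) * Wᴴ := by
  let B : ∀ i, Matrix (m i) (m i) ℂ := fun i => Matrix.of fun x y => H ⟨i, x⟩ ⟨i, y⟩
  have hB : ∀ i, (B i).IsHermitian := fun i => by
    ext x y
    exact congrFun (congrFun hH ⟨i, x⟩) ⟨i, y⟩
  have hHB : H = Matrix.blockDiagonal' B := by
    ext ⟨i, x⟩ ⟨j, y⟩
    by_cases hij : i = j
    · subst hij
      rw [Matrix.blockDiagonal'_apply_eq]
      rfl
    · rw [Matrix.blockDiagonal'_apply_ne _ _ _ hij, hb _ _ hij]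
  let U : ∀ i, Matrix (m i) (m i) ℂ := fun i => ((hB i).eigenvectorUnitary : Matrix _ _ ℂ)
  have hU1 : ∀ i, (U i)ᴴ * U i = 1 := fun i =>
    Matrix.mem_unitaryGroup_iff'.mp (hB i).eigenvectorUnitary.2
  have hU2 : ∀ i, U i * (U i)ᴴ = 1 := fun i =>
    Matrix.mem_unitaryGroup_iff.mp (hB i).eigenvectorUnitary.2
  refine ⟨Matrix.blockDiagonal' U, fun x => (hB x.1).eigenvalues x.2, ?_, ?_, ?_, ?_⟩
  · rintro ⟨i, x⟩ ⟨j, y⟩ hij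
    exact Matrix.blockDiagonal'_apply_ne _ _ _ hij
  · rw [Matrix.blockDiagonal'_conjTranspose, ← Matrix.blockDiagonal'_mul]
    simp only [hU1]
    exact Matrix.blockDiagonal'_one
  · rw [Matrix.blockDiagonal'_conjTranspose, ← Matrix.blockDiagonal'_mul]
    simp only [hU2]
    exact Matrix.blockDiagonal'_one
  · have hd : Matrix.diagonal (fun x : Σ i, m i => (((hB x.1).eigenvalues x.2 : ℝ) : ℂ)) =
        Matrix.blockDiagonal' fun i =>
          Matrix.diagonal fun x => (((hB i).eigenvalues x : ℝ) : ℂ) := by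
      rw [Matrix.blockDiagonal'_diagonal]
    rw [hd, Matrix.blockDiagonal'_conjTranspose, ← Matrix.blockDiagonal'_mul,
      ← Matrix.blockDiagonal'_mul, hHB]
    congr 1
    funext i
    exact (hB i).spectral_theorem

section Commutant

variable {A κ : Type*} [Fintype A] [DecidableEq A] [Fintype κ] [DecidableEq κ] {m : κ → Type*}
  [∀ i, Fintype (m i)] [∀ i, DecidableEq (m i)] {n : ℕ}
  {T : Matrix (A × (Fin n → Σ i, m i)) (A × (Fin n → Σ i, m i)) ℂ}

theorem commute_kronecker_mul {B : Type*} [Fintype B] [DecidableEq B]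
    {T : Matrix (A × B) (A × B) ℂ} {V W : Matrix B B ℂ}
    (hV : Commute T ((1 : Matrix A A ℂ) ⊗ₖ V)) (hW : Commute T ((1 : Matrix A A ℂ) ⊗ₖ W)) :
    Commute T ((1 : Matrix A A ℂ) ⊗ₖ (V * W)) := by
  have : (1 : Matrix A A ℂ) ⊗ₖ (V * W) = ((1 : Matrix A A ℂ) ⊗ₖ V) * (1 ⊗ₖ W) := by
    rw [← Matrix.mul_kronecker_mul, Matrix.one_mul]
  rw [this]
  exact hV.mul_right hW

theorem commute_kronecker_tpow_diagonal
    (hT : ∀ Z : Matrix (Σ i, m i) (Σ i, m i) ℂ, IsBlock Sigma.fst Sigma.fst Z → Zᴴ * Z = 1 →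
      Commute T ((1 : Matrix A A ℂ) ⊗ₖ tpow n Z)) (d : (Σ i, m i) → ℂ) :
    Commute T ((1 : Matrix A A ℂ) ⊗ₖ tpow n (Matrix.diagonal d)) := by
  have key : ∀ d : (Σ i, m i) → ℂ, (1 : Matrix A A ℂ) ⊗ₖ tpow n (Matrix.diagonal d) =
      Matrix.diagonal fun x => ∏ i, d (x.2 i) := by
    intro d
    rw [tpow_diagonal, ← Matrix.diagonal_one, Matrix.diagonal_kronecker_diagonal]
    simp
  have hpoly : ∀ x y, T x y ≠ 0 →
      (∏ i, MvPolynomial.X (y.2 i) : MvPolynomial (Σ i, m i) ℂ) =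
        ∏ i, MvPolynomial.X (x.2 i) := by
    intro x y hxy
    apply MvPolynomial.funext_set (fun _ => (Metric.sphere (0 : ℂ) 1))
    · intro _
      have hc : Set.InjOn (fun t : ℝ => Complex.exp (t * Complex.I))
          (Set.Ioo (-Real.pi) Real.pi) := by
        intro s hs t ht hst
        have h1 := congrArg Complex.arg hst
        simp only [Complex.arg_exp_mul_I] at h1
        rwa [(toIocMod_eq_self _).2 ⟨hs.1, by linarith [hs.2]⟩,
          (toIocMod_eq_self _).2 ⟨ht.1, by linarith [ht.2]⟩] at h1
      refine Set.Infinite.mono ?_ ((Set.Ioo_infinite (by linarith [Real.pi_pos])).image hc)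
      rintro _ ⟨t, -, rfl⟩
      simp [Complex.norm_exp_ofReal_mul_I]
    · intro θ hθ
      have hθ' : ∀ z, star (θ z) * θ z = 1 := by
        intro z
        have h1 : ‖θ z‖ = 1 := by simpa using hθ z (Set.mem_univ z)
        have h2 := Complex.conj_mul' (θ z)
        rw [h1] at h2
        simpa using h2
      have h := hT (Matrix.diagonal θ) (IsBlock.diagonal _ _) (by
        rw [Matrix.diagonal_conjTranspose, Matrix.diagonal_mul_diagonal, ← Matrix.diagonal_one]
        congr 1
        funext z
        exact hθ' z)
      rw [key] at h
      have h1 := congrFun (congrFun h.eq x) y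
      rw [Matrix.mul_diagonal, Matrix.diagonal_mul, mul_comm] at h1
      simpa using mul_right_cancel₀ hxy h1
  rw [key]
  ext x y
  rw [Matrix.mul_diagonal, Matrix.diagonal_mul]
  by_cases hxy : T x y = 0
  · rw [hxy, zero_mul, mul_zero]
  · have h := congrArg (MvPolynomial.eval d) (hpoly x y hxy)
    simp only [map_prod, MvPolynomial.eval_X] at h
    rw [h, mul_comm]

/-- A matrix commuting with `1 ⊗ Z^⊗n` for all block-diagonal unitaries `Z` commutes with `1 ⊗ V`
for all permutation-invariant block-diagonal `V`. -/
theorem commute_kronecker_of_symmetric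
    (hT : ∀ Z : Matrix (Σ i, m i) (Σ i, m i) ℂ, IsBlock Sigma.fst Sigma.fst Z → Zᴴ * Z = 1 →
      Commute T ((1 : Matrix A A ℂ) ⊗ₖ tpow n Z))
    {V : Matrix (Fin n → Σ i, m i) (Fin n → Σ i, m i) ℂ}
    (hV : ∀ (π : Equiv.Perm (Fin n)) v w, V (v ∘ π) (w ∘ π) = V v w)
    (hVb : ∀ v w, (∃ i, (v i).1 ≠ (w i).1) → V v w = 0) :
    Commute T ((1 : Matrix A A ℂ) ⊗ₖ V) := by
  have hherm : ∀ H : Matrix (Σ i, m i) (Σ i, m i) ℂ, H.IsHermitian →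
      IsBlock Sigma.fst Sigma.fst H → Commute T ((1 : Matrix A A ℂ) ⊗ₖ tpow n H) := by
    intro H hH hHb
    obtain ⟨W, d, hWb, hW1, hW2, rfl⟩ := exists_block_spectral hH hHb
    rw [tpow_mul, tpow_mul]
    refine commute_kronecker_mul (commute_kronecker_mul (hT W hWb hW1)
      (commute_kronecker_tpow_diagonal hT _)) (hT _ hWb.conjTranspose ?_)
    rw [Matrix.conjTranspose_conjTranspose, hW2]
  let ℓ : ∀ x y : A × (Fin n → Σ i, m i),
      Matrix (Fin n → Σ i, m i) (Fin n → Σ i, m i) ℂ →ₗ[ℂ] ℂ := fun x y =>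
    { toFun := fun V => (T * ((1 : Matrix A A ℂ) ⊗ₖ V) - ((1 : Matrix A A ℂ) ⊗ₖ V) * T) x y
      map_add' := fun V W => by
        rw [Matrix.kronecker_add, Matrix.mul_add, Matrix.add_mul]
        simp only [Matrix.sub_apply, Matrix.add_apply]
        ring
      map_smul' := fun c V => by
        rw [Matrix.kronecker_smul, Matrix.mul_smul, Matrix.smul_mul]
        simp only [Matrix.sub_apply, Matrix.smul_apply, RingHom.id_apply, smul_eq_mul]
        ring }
  have hℓ : ∀ V, Commute T ((1 : Matrix A A ℂ) ⊗ₖ V) ↔ ∀ x y, ℓ x y V = 0 := by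
    intro V
    constructor
    · intro h x y
      change (T * ((1 : Matrix A A ℂ) ⊗ₖ V) - ((1 : Matrix A A ℂ) ⊗ₖ V) * T) x y = 0
      rw [h.eq, sub_self, Matrix.zero_apply]
    · intro h
      refine sub_eq_zero.mp ?_
      ext x y
      exact h x y
  have hall : ∀ X : Matrix (Σ i, m i) (Σ i, m i) ℂ, IsBlock Sigma.fst Sigma.fst X →
      Commute T ((1 : Matrix A A ℂ) ⊗ₖ tpow n X) := by
    intro X hX
    rw [hℓ]
    intro x y
    let H₁ := (1 / 2 : ℂ) • (X + Xᴴ)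
    let H₂ := (-Complex.I / 2 : ℂ) • (X + (-1 : ℂ) • Xᴴ)
    have hH₁ : H₁.IsHermitian := by
      simp only [H₁, Matrix.IsHermitian, Matrix.conjTranspose_smul, Matrix.conjTranspose_add,
        Matrix.conjTranspose_conjTranspose, add_comm]
      simp
    have hH₂ : H₂.IsHermitian := by
      ext u v
      simp [H₂, Matrix.conjTranspose_apply]
      ring
    have hb₁ : IsBlock Sigma.fst Sigma.fst H₁ := (hX.add hX.conjTranspose).smul _
    have hb₂ : IsBlock Sigma.fst Sigma.fst H₂ := (hX.add (hX.conjTranspose.smul _)).smul _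
    have hX12 : X = H₁ + Complex.I • H₂ := by
      ext u v
      simp only [H₁, H₂, Matrix.add_apply, Matrix.smul_apply, smul_eq_mul]
      linear_combination (1 / 2 : ℂ) * (X u v - Xᴴ u v) * Complex.I_mul_I
    rw [hX12]
    refine linearMap_tpow_eq_zero_of_real (ℓ x y) H₁ H₂ (fun t => ?_) Complex.I
    refine (hℓ _).mp (hherm _ ?_ (hb₁.add (hb₂.smul _))) x y
    refine hH₁.add ?_
    rw [Matrix.IsHermitian, Matrix.conjTranspose_smul, hH₂.eq]
    simp
  rw [hℓ]
  intro x y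
  let J : ((Fin n → (Σ i, m i) × (Σ i, m i)) → ℂ) →ₗ[ℂ]
      Matrix (Fin n → Σ i, m i) (Fin n → Σ i, m i) ℂ :=
    { toFun := fun f => Matrix.of fun v w => f fun i => (v i, w i)
      map_add' := fun _ _ => rfl
      map_smul' := fun _ _ => rfl }
  let L : ((Fin n → (Σ i, m i) × (Σ i, m i)) → ℂ) →ₗ[ℂ] ℂ := (ℓ x y).comp J
  refine linearMap_eq_zero_of_symmetric (fun q => q.1.1 = q.2.1) L (fun z hz => ?_)
    (fun q => V (fun i => (q i).1) fun i => (q i).2) (fun π q => ?_) (fun q hq => ?_)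
  · refine (hℓ _).mp (hall (Matrix.of fun u v => z (u, v)) fun u v huv => ?_) x y
    exact hz (u, v) huv
  · exact hV π (fun i => (q i).1) fun i => (q i).2
  · exact hVb _ _ hq

end Commutant

section Purification

variable {κ : Type*} [Fintype κ] [DecidableEq κ] {m q : κ → Type*}
  [∀ i, Fintype (m i)] [∀ i, DecidableEq (m i)] [∀ i, Fintype (q i)] [∀ i, DecidableEq (q i)]
  {n : ℕ} {σ : Matrix (Σ i, m i) (Σ i, m i) ℂ}
  {N : Matrix (Fin n → Σ i, m i) (Fin n → Σ i, q i) ℂ}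

theorem isBlock_of_tpow_eq (hn : 0 < n)
    (hN : IsBlock (fun v j => (v j).1) (fun w j => (w j).1) N)
    (hNσ : N * Nᴴ = tpow n σ) : IsBlock Sigma.fst Sigma.fst σ := by
  intro x y hxy
  have h := (hN.mul hN.conjTranspose) (fun _ => x) (fun _ => y)
    fun h => hxy (congrFun h ⟨0, hn⟩)
  rw [hNσ, tpow_apply, Finset.prod_const] at h
  exact pow_eq_zero_iff (by simpa using hn.ne') |>.mp h

/-- The number of nonzero eigenvalues in a block is bounded by the size of the block of the
purifying system. -/
theorem card_ne_zero_le (hn : 0 < n) {d : (Σ i, m i) → ℝ}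
    (hN : IsBlock (fun v j => (v j).1) (fun w j => (w j).1) N)
    (hNd : N * Nᴴ = tpow n (Matrix.diagonal fun x => (d x : ℂ))) (i : κ) :
    Fintype.card {x : m i // d ⟨i, x⟩ ≠ 0} ≤ Fintype.card (q i) := by
  classical
  let R : Matrix (Fin n → {x : m i // d ⟨i, x⟩ ≠ 0}) (Fin n → q i) ℂ :=
    Matrix.of fun f g => N (fun j => ⟨i, (f j).1⟩) fun j => ⟨i, g j⟩
  have hR : R * Rᴴ = Matrix.diagonal fun f => ∏ j, ((d ⟨i, (f j).1⟩ : ℝ) : ℂ) := by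
    ext f f'
    have h1 : (R * Rᴴ) f f' = (N * Nᴴ) (fun j => ⟨i, (f j).1⟩) fun j => ⟨i, (f' j).1⟩ := by
      rw [Matrix.mul_apply, Matrix.mul_apply]
      apply Fintype.sum_of_injective (fun (g : Fin n → q i) j => (⟨i, g j⟩ : Σ i, q i))
      · intro g g' h
        funext j
        simpa using congrFun h j
      · intro z hz
        rw [hN _ z, zero_mul]
        intro h
        apply hz
        have h' : ∀ j, ∃ y : q i, (⟨i, y⟩ : Σ i, q i) = z j := by
          intro j
          have hj : i = (z j).1 := congrFun h j
          generalize z j = s at hj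
          obtain ⟨l, y⟩ := s
          cases hj
          exact ⟨y, rfl⟩
        choose g hg using h'
        exact ⟨g, funext hg⟩
      · intro g
        rfl
    rw [h1, hNd, tpow_diagonal, Matrix.diagonal_apply, Matrix.diagonal_apply]
    by_cases hf : f = f'
    · subst hf; simp
    · rw [if_neg hf, if_neg]
      intro h
      apply hf
      funext j
      apply Subtype.ext
      simpa using congrFun h j
  have h2 : (R * Rᴴ).rank ≤ Fintype.card (Fin n → q i) :=
    (Matrix.rank_mul_le_left R Rᴴ).trans (Matrix.rank_le_card_width R)
  have h3 : (R * Rᴴ).rank = Fintype.card (Fin n → {x : m i // d ⟨i, x⟩ ≠ 0}) := by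
    rw [hR]
    apply Matrix.rank_of_isUnit
    rw [Matrix.isUnit_diagonal, Pi.isUnit_iff]
    intro f
    rw [isUnit_iff_ne_zero, Finset.prod_ne_zero_iff]
    intro j _
    exact_mod_cast (f j).2
  rw [h3, Fintype.card_fun, Fintype.card_fun, Fintype.card_fin] at h2
  exact (Nat.pow_le_pow_iff_left hn.ne').mp h2

/-- If `σ^⊗n` has a block-compatible purification, then so has `σ`. -/
theorem exists_block_purification (hn : 0 < n) (hσ : σ.PosSemidef)
    (hN : IsBlock (fun v j => (v j).1) (fun w j => (w j).1) N) (hNσ : N * Nᴴ = tpow n σ) :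
    ∃ M : Matrix (Σ i, m i) (Σ i, q i) ℂ, IsBlock Sigma.fst Sigma.fst M ∧ M * Mᴴ = σ := by
  classical
  obtain ⟨W, d, hWb, hW1, hW2, hWσ⟩ := exists_block_spectral hσ.1 (isBlock_of_tpow_eq hn hN hNσ)
  have hdiag : Wᴴ * σ * W = Matrix.diagonal fun x => (d x : ℂ) := by
    rw [hWσ]
    calc Wᴴ * (W * Matrix.diagonal (fun x => (d x : ℂ)) * Wᴴ) * W
        = (Wᴴ * W) * Matrix.diagonal (fun x => (d x : ℂ)) * (Wᴴ * W) := by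
          simp only [Matrix.mul_assoc]
      _ = _ := by rw [hW1, Matrix.one_mul, Matrix.mul_one]
  have hd : ∀ x, 0 ≤ d x := by
    have h := hσ.conjTranspose_mul_mul_same W
    rw [hdiag, Matrix.posSemidef_diagonal_iff] at h
    intro x
    exact_mod_cast h x
  have hcard := card_ne_zero_le (N := tpow n Wᴴ * N) (d := d) hn
    (hWb.conjTranspose.tpow.mul hN) (by
      rw [Matrix.conjTranspose_mul, ← tpow_conjTranspose, Matrix.conjTranspose_conjTranspose,
        ← hdiag, tpow_mul, tpow_mul, ← hNσ]
      simp only [Matrix.mul_assoc])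
  have e := fun i => (Function.Embedding.nonempty_of_card_le (hcard i)).some
  let e' : ∀ x : Σ i, m i, d x ≠ 0 → Σ i, q i := fun x hx => ⟨x.1, e x.1 ⟨x.2, hx⟩⟩
  have he' : ∀ x hx y hy, e' x hx = e' y hy → x = y := by
    rintro ⟨i, x⟩ hx ⟨j, y⟩ hy h
    obtain ⟨rfl, h2⟩ := Sigma.mk.inj_iff.mp h
    have := (e i).injective (eq_of_heq h2)
    simpa using this
  let J : Matrix (Σ i, m i) (Σ i, q i) ℂ := Matrix.of fun x y =>
    if hx : d x ≠ 0 then (if e' x hx = y then ((Real.sqrt (d x) : ℝ) : ℂ) else 0) else 0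
  have hJb : IsBlock Sigma.fst Sigma.fst J := by
    intro x y hxy
    simp only [J, Matrix.of_apply]
    split_ifs with hx h
    · exact absurd (congrArg Sigma.fst h) hxy
    · rfl
    · rfl
  have hJ : J * Jᴴ = Matrix.diagonal fun x => (d x : ℂ) := by
    ext x x'
    rw [Matrix.mul_apply, Matrix.diagonal_apply]
    by_cases hx : d x ≠ 0
    · have hJx : ∀ y, J x y = if e' x hx = y then ((Real.sqrt (d x) : ℝ) : ℂ) else 0 := by
        intro y
        simp only [J, Matrix.of_apply, dif_pos hx]
      simp only [hJx, ite_mul, zero_mul, Finset.sum_ite_eq, Finset.mem_univ, if_true,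
        Matrix.conjTranspose_apply]
      by_cases hxx : x = x'
      · subst hxx
        rw [hJx, if_pos rfl, if_pos rfl]
        simp only [Complex.star_def, Complex.conj_ofReal]
        exact_mod_cast Real.mul_self_sqrt (hd x)
      · rw [if_neg hxx]
        have : J x' (e' x hx) = 0 := by
          simp only [J, Matrix.of_apply]
          split_ifs with hx' h
          · exact absurd (he' _ _ _ _ h).symm hxx
          · rfl
          · rfl
        rw [this, star_zero, mul_zero]
    · have hJx : ∀ y, J x y = 0 := by
        intro y
        simp only [J, Matrix.of_apply, dif_neg hx]
      push Not at hx
      simp [hJx, hx]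
  refine ⟨W * J, hWb.mul hJb, ?_⟩
  rw [Matrix.conjTranspose_mul, hWσ, ← hJ]
  simp only [Matrix.mul_assoc]

end Purification

section Intertwiner

/-- Invariance of a matrix on tensor powers under simultaneous permutation of the factors. -/
def PermInvariant {m p : Type*} {n : ℕ} (N : Matrix (Fin n → m) (Fin n → p) ℂ) : Prop :=
  ∀ (π : Equiv.Perm (Fin n)) v w, N (v ∘ π) (w ∘ π) = N v w

theorem PermInvariant.mul {m p q : Type*} [Fintype p] [DecidableEq p] {n : ℕ}
    {M : Matrix (Fin n → m) (Fin n → p) ℂ} {N : Matrix (Fin n → p) (Fin n → q) ℂ}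
    (hM : PermInvariant M) (hN : PermInvariant N) : PermInvariant (M * N) := by
  intro π v w
  rw [Matrix.mul_apply, Matrix.mul_apply,
    ← Equiv.sum_comp (Equiv.arrowCongr π.symm (Equiv.refl p))]
  refine Finset.sum_congr rfl fun z _ => ?_
  exact congrArg₂ (· * ·) (hM π v z) (hN π z w)

theorem mul_mul_eq_self_of_mul_conjTranspose {A B : Type*} [Fintype A] [Fintype B] [DecidableEq A]
    {σ S : Matrix A A ℂ} {X : Matrix A B ℂ} (hS : σ * S * σ = σ) (hX : X * Xᴴ = σ) :
    σ * S * X = X := by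
  have h : (σ * S * X - X) * (σ * S * X - X)ᴴ = 0 := by
    calc (σ * S * X - X) * (σ * S * X - X)ᴴ
        = (σ * S * (X * Xᴴ) - X * Xᴴ) * ((σ * S)ᴴ - 1) := by
          simp only [Matrix.conjTranspose_sub, Matrix.conjTranspose_mul, Matrix.sub_mul,
            Matrix.mul_sub, Matrix.mul_assoc, Matrix.mul_one]
      _ = 0 := by rw [hX, hS, sub_self, Matrix.zero_mul]
  rw [Matrix.self_mul_conjTranspose_eq_zero] at h
  exact sub_eq_zero.mp h

variable {κ : Type*} [Fintype κ] [DecidableEq κ] {m q : κ → Type*}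
  [∀ i, Fintype (m i)] [∀ i, DecidableEq (m i)] [∀ i, Fintype (q i)] [∀ i, DecidableEq (q i)]
  {n : ℕ}

theorem exists_block_generalized_inverse {σ : Matrix (Σ i, m i) (Σ i, m i) ℂ}
    (hσ : σ.IsHermitian) (hb : IsBlock Sigma.fst Sigma.fst σ) :
    ∃ S, IsBlock Sigma.fst Sigma.fst S ∧ Sᴴ = S ∧ σ * S * σ = σ := by
  obtain ⟨W, d, hWb, hW1, hW2, rfl⟩ := exists_block_spectral hσ hb
  refine ⟨W * Matrix.diagonal (fun x => ((d x)⁻¹ : ℂ)) * Wᴴ,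
    (hWb.mul (IsBlock.diagonal _ _)).mul hWb.conjTranspose, ?_, ?_⟩
  · rw [Matrix.conjTranspose_mul, Matrix.conjTranspose_mul, Matrix.conjTranspose_conjTranspose,
      Matrix.diagonal_conjTranspose, Matrix.mul_assoc]
    congr 3
    funext x
    simp
  · have h : ∀ D E : Matrix (Σ i, m i) (Σ i, m i) ℂ,
        (W * D * Wᴴ) * (W * E * Wᴴ) = W * (D * E) * Wᴴ := by
      intro D E
      calc (W * D * Wᴴ) * (W * E * Wᴴ) = W * D * (Wᴴ * W) * E * Wᴴ := by
            simp only [Matrix.mul_assoc]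
        _ = _ := by rw [hW1, Matrix.mul_one]; simp only [Matrix.mul_assoc]
    rw [h, h, Matrix.diagonal_mul_diagonal, Matrix.diagonal_mul_diagonal]
    congr 3
    funext x
    exact mul_inv_mul_cancel (d x : ℂ)

/-- Two symmetric purifications of `σ^⊗n`, one of which is a tensor power, are related by a
permutation-invariant partial isometry on the purifying systems. -/
theorem exists_intertwiner {σ : Matrix (Σ i, m i) (Σ i, m i) ℂ}
    (hσ : σ.IsHermitian) (hσb : IsBlock Sigma.fst Sigma.fst σ)
    {M : Matrix (Σ i, m i) (Σ i, q i) ℂ} (hM : IsBlock Sigma.fst Sigma.fst M) (hMσ : M * Mᴴ = σ)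
    {N : Matrix (Fin n → Σ i, m i) (Fin n → Σ i, q i) ℂ} (hNs : PermInvariant N)
    (hN : IsBlock (fun v j => (v j).1) (fun w j => (w j).1) N) (hNσ : N * Nᴴ = tpow n σ) :
    ∃ V : Matrix (Fin n → Σ i, q i) (Fin n → Σ i, q i) ℂ, PermInvariant V ∧
      IsBlock (fun v j => (v j).1) (fun w j => (w j).1) V ∧ tpow n M * V = N ∧
        N * Vᴴ = tpow n M := by
  obtain ⟨S, hSb, hS, hσS⟩ := exists_block_generalized_inverse hσ hσb
  have hσS' : tpow n σ * tpow n S * tpow n σ = tpow n σ := by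
    rw [← tpow_mul, ← tpow_mul, hσS]
  have hMσ' : tpow n M * (tpow n M)ᴴ = tpow n σ := by
    rw [← tpow_conjTranspose, ← tpow_mul, hMσ]
  refine ⟨(tpow n M)ᴴ * tpow n S * N, ?_, ?_, ?_, ?_⟩
  · rw [← tpow_conjTranspose]
    exact PermInvariant.mul (PermInvariant.mul (fun π v w => tpow_comp_perm _ π v w)
      fun π v w => tpow_comp_perm _ π v w) hNs
  · exact (hM.tpow.conjTranspose.mul hSb.tpow).mul hN
  · rw [← Matrix.mul_assoc, ← Matrix.mul_assoc, hMσ']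
    exact mul_mul_eq_self_of_mul_conjTranspose hσS' hNσ
  · rw [Matrix.conjTranspose_mul, Matrix.conjTranspose_mul, Matrix.conjTranspose_conjTranspose,
      ← tpow_conjTranspose, hS, ← Matrix.mul_assoc, ← Matrix.mul_assoc, hNσ]
    exact mul_mul_eq_self_of_mul_conjTranspose hσS' hMσ'

end Intertwiner

section Positivity

variable {ι : Type*} [Fintype ι] [DecidableEq ι]

/-- Regularized inverse of a positive semidefinite matrix, with a trace bound in terms of rank. -/
theorem exists_regularized_inverse {T : Matrix ι ι ℂ} (hT : T.PosSemidef) {ε : ℝ} (hε : 0 < ε) :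
    ∃ S : Matrix ι ι ℂ, S * (T + (ε : ℂ) • 1) = 1 ∧ (T + (ε : ℂ) • 1) * S = 1 ∧ Sᴴ = S ∧
      (S * T).trace.re ≤ T.rank := by
  classical
  let U : Matrix ι ι ℂ := (hT.1.eigenvectorUnitary : Matrix ι ι ℂ)
  let l := hT.1.eigenvalues
  have hl : ∀ i, 0 ≤ l i := hT.eigenvalues_nonneg
  have hU1 : Uᴴ * U = 1 := Matrix.mem_unitaryGroup_iff'.mp hT.1.eigenvectorUnitary.2
  have hU2 : U * Uᴴ = 1 := Matrix.mem_unitaryGroup_iff.mp hT.1.eigenvectorUnitary.2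
  have hTU : T = U * Matrix.diagonal (fun i => (l i : ℂ)) * Uᴴ := hT.1.spectral_theorem
  have h : ∀ D E : Matrix ι ι ℂ, (U * D * Uᴴ) * (U * E * Uᴴ) = U * (D * E) * Uᴴ := by
    intro D E
    calc (U * D * Uᴴ) * (U * E * Uᴴ) = U * D * (Uᴴ * U) * E * Uᴴ := by
          simp only [Matrix.mul_assoc]
      _ = _ := by rw [hU1, Matrix.mul_one]; simp only [Matrix.mul_assoc]
  have hTε : T + (ε : ℂ) • 1 = U * Matrix.diagonal (fun i => ((l i + ε : ℝ) : ℂ)) * Uᴴ := by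
    have : Matrix.diagonal (fun i => ((l i + ε : ℝ) : ℂ)) =
        Matrix.diagonal (fun i => (l i : ℂ)) + (ε : ℂ) • (1 : Matrix ι ι ℂ) := by
      rw [Matrix.smul_one_eq_diagonal, Matrix.diagonal_add]
      simp
    rw [this, Matrix.mul_add, Matrix.add_mul, ← hTU, Matrix.mul_smul, Matrix.smul_mul,
      Matrix.mul_one, hU2]
  have hne : ∀ i, ((l i + ε : ℝ) : ℂ) ≠ 0 := fun i =>
    Complex.ofReal_ne_zero.mpr (by have := hl i; positivity)
  refine ⟨U * Matrix.diagonal (fun i => (((l i + ε)⁻¹ : ℝ) : ℂ)) * Uᴴ, ?_, ?_, ?_, ?_⟩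
  · rw [hTε, h, Matrix.diagonal_mul_diagonal]
    have : (fun i => (((l i + ε)⁻¹ : ℝ) : ℂ) * ((l i + ε : ℝ) : ℂ)) = fun _ => 1 := by
      funext i
      rw [Complex.ofReal_inv, inv_mul_cancel₀ (hne i)]
    rw [this, Matrix.diagonal_one, Matrix.mul_one, hU2]
  · rw [hTε, h, Matrix.diagonal_mul_diagonal]
    have : (fun i => ((l i + ε : ℝ) : ℂ) * (((l i + ε)⁻¹ : ℝ) : ℂ)) = fun _ => 1 := by
      funext i
      rw [Complex.ofReal_inv, mul_inv_cancel₀ (hne i)]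
    rw [this, Matrix.diagonal_one, Matrix.mul_one, hU2]
  · rw [Matrix.conjTranspose_mul, Matrix.conjTranspose_mul, Matrix.conjTranspose_conjTranspose,
      Matrix.diagonal_conjTranspose, Matrix.mul_assoc]
    congr 3
    funext x
    simp
  · rw [hT.1.rank_eq_card_non_zero_eigs]
    conv_lhs => rw [hTU]
    rw [h, Matrix.diagonal_mul_diagonal, Matrix.mul_assoc, Matrix.trace_mul_comm, Matrix.mul_assoc,
      hU1, Matrix.mul_one, Matrix.trace_diagonal, Fintype.card_subtype, Finset.card_filter]
    push_cast
    rw [Complex.re_sum]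
    refine Finset.sum_le_sum fun i _ => ?_
    have h1 : ((((l i : ℂ) + ε)⁻¹) * (l i : ℂ)).re = (l i + ε)⁻¹ * l i := by
      rw [← Complex.ofReal_add, ← Complex.ofReal_inv, ← Complex.ofReal_mul, Complex.ofReal_re]
    rw [h1]
    split_ifs with hi
    · rw [inv_mul_le_iff₀ (by have := hl i; positivity)]
      linarith
    · push Not at hi
      simp only [l, hi, mul_zero, le_refl]

/-- A Cauchy-Schwarz type bound: `|ψ⟩⟨ψ| ≤ c A` whenever `⟨ψ, A⁻¹ ψ⟩ ≤ c`. -/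
theorem normSq_dotProduct_le {A : Matrix ι ι ℂ} (hA : A.PosSemidef) {y ψ : ι → ℂ}
    (hy : A *ᵥ y = ψ) {c : ℝ} (hc : 0 < c) (hyc : (star y ⬝ᵥ ψ).re ≤ c) (w : ι → ℂ) :
    Complex.normSq (star ψ ⬝ᵥ w) ≤ c * (star w ⬝ᵥ (A *ᵥ w)).re := by
  set s := star ψ ⬝ᵥ w with hs
  have h1 : star w ⬝ᵥ ψ = star s := by
    rw [hs, Matrix.star_dotProduct]
  have h2 : star y ⬝ᵥ (A *ᵥ w) = s := by
    rw [Matrix.dotProduct_mulVec, ← hA.1.eq, ← Matrix.star_mulVec, hy]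
  have h := hA.re_dotProduct_nonneg ((c : ℂ) • w - s • y)
  have h3 : star ((c : ℂ) • w - s • y) ⬝ᵥ (A *ᵥ ((c : ℂ) • w - s • y)) =
      c * (c * (star w ⬝ᵥ (A *ᵥ w))) - 2 * c * (s * star s) + (s * star s) * (star y ⬝ᵥ ψ) := by
    simp only [star_sub, star_smul, Matrix.mulVec_sub, Matrix.mulVec_smul, sub_dotProduct,
      dotProduct_sub, smul_dotProduct, dotProduct_smul, h2, hy, h1, smul_eq_mul,
      Complex.star_def, Complex.conj_ofReal]
    ring
  have h4 : s * star s = ((Complex.normSq s : ℝ) : ℂ) := Complex.mul_conj s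
  rw [h3, h4] at h
  simp only [RCLike.re_to_complex, Complex.sub_re, Complex.add_re, Complex.re_ofReal_mul,
    ← Complex.ofReal_ofNat, mul_assoc, Complex.ofReal_re] at h
  have h5 := mul_le_mul_of_nonneg_left hyc (Complex.normSq_nonneg s)
  have h6 : 0 ≤ c * (c * (star w ⬝ᵥ (A *ᵥ w)).re - Complex.normSq s) := by linarith
  linarith [nonneg_of_mul_nonneg_right h6 hc]

/-- If `⟨ψ, (T + ε)⁻¹ ψ⟩` is bounded by `g` for all `ε > 0`, then `|ψ⟩⟨ψ| ≤ g T`. -/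
theorem posSemidef_smul_sub_of_forall {T : Matrix ι ι ℂ} (hT : T.PosSemidef) (ψ : ι → ℂ) {g : ℝ}
    (hg : 0 ≤ g)
    (h : ∀ ε : ℝ, 0 < ε → ∃ y, (T + (ε : ℂ) • 1) *ᵥ y = ψ ∧ (star y ⬝ᵥ ψ).re ≤ g) :
    ((g : ℂ) • T - Matrix.vecMulVec ψ (star ψ)).PosSemidef := by
  apply Matrix.PosSemidef.of_dotProduct_mulVec_nonneg
  · refine Matrix.IsHermitian.sub ?_ (Matrix.posSemidef_vecMulVec_self_star ψ).1
    rw [Matrix.IsHermitian, Matrix.conjTranspose_smul, hT.1.eq]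
    simp
  intro w
  have hbound : ∀ ε : ℝ, 0 < ε → Complex.normSq (star ψ ⬝ᵥ w) ≤
      (g + ε) * ((star w ⬝ᵥ (T *ᵥ w)).re + ε * (star w ⬝ᵥ w).re) := by
    intro ε hε
    obtain ⟨y, hy, hyg⟩ := h ε hε
    have hA : (T + (ε : ℂ) • (1 : Matrix ι ι ℂ)).PosSemidef :=
      hT.add (Matrix.PosSemidef.one.smul (by exact_mod_cast hε.le))
    have h1 := normSq_dotProduct_le hA hy (c := g + ε) (by linarith) (by linarith) w
    rw [Matrix.add_mulVec, Matrix.smul_mulVec, Matrix.one_mulVec, dotProduct_add,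
      dotProduct_smul, smul_eq_mul, Complex.add_re, Complex.re_ofReal_mul] at h1
    exact h1
  have hlim : Complex.normSq (star ψ ⬝ᵥ w) ≤ g * (star w ⬝ᵥ (T *ᵥ w)).re := by
    have hcont : Continuous fun ε : ℝ =>
        (g + ε) * ((star w ⬝ᵥ (T *ᵥ w)).re + ε * (star w ⬝ᵥ w).re) := by fun_prop
    have htend := (hcont.tendsto 0).mono_left (nhdsWithin_le_nhds (s := Set.Ioi 0))
    simp only [add_zero, zero_mul] at htend
    exact ge_of_tendsto htend (by
      filter_upwards [self_mem_nhdsWithin] with ε hε using hbound ε hε)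
  have him : (star w ⬝ᵥ (T *ᵥ w)).im = 0 :=
    ((Complex.le_def.mp (hT.dotProduct_mulVec_nonneg w)).2).symm
  have hv : star w ⬝ᵥ (Matrix.vecMulVec ψ (star ψ) *ᵥ w) =
      ((Complex.normSq (star ψ ⬝ᵥ w) : ℝ) : ℂ) := by
    rw [Matrix.vecMulVec_mulVec, dotProduct_smul, ← Complex.mul_conj, ← Complex.star_def,
      Matrix.star_dotProduct]
    simp [mul_comm]
  rw [Matrix.sub_mulVec, Matrix.smul_mulVec, dotProduct_sub, dotProduct_smul, smul_eq_mul, hv,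
    Complex.le_def]
  constructor
  · rw [Complex.sub_re, Complex.re_ofReal_mul, Complex.ofReal_re, Complex.zero_re]
    linarith
  · rw [Complex.sub_im, Complex.im_ofReal_mul, him, Complex.ofReal_im]
    simp

end Positivity

section Vectorization

variable {A B : Type*} [Fintype A] [DecidableEq A] [Fintype B]

/-- A bipartite matrix read as a vector. -/
def vec (N : Matrix A B ℂ) : A × B → ℂ := fun p => N p.1 p.2

omit [Fintype A] [DecidableEq A] [Fintype B] in
theorem vec_apply (N : Matrix A B ℂ) (p : A × B) : vec N p = N p.1 p.2 := rfl

theorem kronecker_mulVec_vec (W : Matrix B B ℂ) (N : Matrix A B ℂ) :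
    ((1 : Matrix A A ℂ) ⊗ₖ W) *ᵥ vec N = vec (N * Wᵀ) := by
  ext ⟨x, y⟩
  simp only [Matrix.mulVec, dotProduct, Fintype.sum_prod_type, Matrix.kroneckerMap_apply, vec_apply,
    Matrix.mul_apply, Matrix.transpose_apply, Matrix.one_apply, ite_mul, one_mul, zero_mul]
  rw [Finset.sum_eq_single x]
  · simp [mul_comm]
  · intro b _ hb
    simp [hb.symm]
  · simp

end Vectorization

/-- The rank of a matrix supported on the symmetric subspace is at most the number of multisets
of indices in the support. -/
theorem rank_le_choose {X I : Type*} [Fintype X] [DecidableEq X] [Fintype I] [DecidableEq I]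
    (P : X → Prop) [DecidablePred P] {n : ℕ} (e : I ≃ (Fin n → X)) {T : Matrix I I ℂ}
    (hT : ∀ (π : Equiv.Perm (Fin n)) v q, T (e.symm (v ∘ π)) q = T (e.symm v) q)
    (hP : ∀ v q, (∃ j, ¬ P (v j)) → T (e.symm v) q = 0) :
    T.rank ≤ (Fintype.card {x // P x} + n - 1).choose n := by
  let s : (Fin n → {x // P x}) → Sym {x // P x} n := fun v =>
    ⟨Finset.univ.val.map v, by simp⟩
  have hs : ∀ v w, s v = s w → ∃ π : Equiv.Perm (Fin n), w ∘ π = v := by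
    intro v w h
    apply exists_perm_comp_eq
    intro d
    have h2 := congrArg (fun m => Multiset.count d m) (congrArg Subtype.val h)
    simp only [s, Multiset.count_map] at h2
    rw [Fintype.card_subtype, Fintype.card_subtype]
    simpa [Finset.card, eq_comm] using h2
  let L : Matrix I (Sym {x // P x} n) ℂ := Matrix.of fun p c =>
    if h : ∀ j, P (e p j) then (if s (fun j => ⟨e p j, h j⟩) = c then 1 else 0) else 0
  let R : Matrix (Sym {x // P x} n) I ℂ := Matrix.of fun c q =>
    if h : ∃ v, s v = c then T (e.symm fun j => (h.choose j).1) q else 0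
  have hLR : T = L * R := by
    ext p q
    obtain ⟨v, rfl⟩ := e.symm.surjective p
    rw [Matrix.mul_apply]
    by_cases h : ∀ j, P (v j)
    · have h' : ∀ j, P (e (e.symm v) j) := by simpa using h
      simp only [L, R, Matrix.of_apply, dif_pos h', ite_mul, one_mul, zero_mul,
        Finset.sum_ite_eq, Finset.mem_univ, if_true]
      have hex : ∃ w, s w = s fun j => ⟨e (e.symm v) j, h' j⟩ := ⟨_, rfl⟩
      rw [dif_pos hex]
      obtain ⟨π, hπ⟩ := hs _ _ hex.choose_spec
      rw [← hT π v q]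
      congr 2
      funext j
      have := congrArg Subtype.val (congrFun hπ j)
      simpa using this
    · rw [hP v q (by simpa using h)]
      refine (Finset.sum_eq_zero fun c _ => ?_).symm
      have h' : ¬ ∀ j, P (e (e.symm v) j) := by simpa using h
      simp only [L, Matrix.of_apply, dif_neg h', zero_mul]
  calc T.rank = (L * R).rank := by rw [← hLR]
    _ ≤ L.rank := Matrix.rank_mul_le_left _ _
    _ ≤ Fintype.card (Sym {x // P x} n) := Matrix.rank_le_card_width _
    _ = _ := Sym.card_sym_eq_choose _

section Reduction

variable {κ : Type*} [Fintype κ] [DecidableEq κ] {m q : κ → Type*}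
  [∀ i, Fintype (m i)] [∀ i, DecidableEq (m i)] [∀ i, Fintype (q i)] [∀ i, DecidableEq (q i)]
  {n : ℕ}

/-- The rank-one operator of the `n`-th tensor power of a bipartite matrix. -/
def state {α β : Type*} (n : ℕ) (M : Matrix α β ℂ) :
    Matrix ((Fin n → α) × (Fin n → β)) ((Fin n → α) × (Fin n → β)) ℂ :=
  Matrix.vecMulVec (vec (tpow n M)) (star (vec (tpow n M)))

theorem continuous_state {α β : Type*} (n : ℕ) :
    Continuous (state n : Matrix α β ℂ → _) := by
  refine continuous_pi fun p => continuous_pi fun p' => ?_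
  simp only [state, Matrix.vecMulVec_apply, Pi.star_apply, vec_apply, tpow_apply]
  fun_prop

theorem posSemidef_state {α β : Type*} [Fintype α] [Fintype β] (n : ℕ) (M : Matrix α β ℂ) :
    (state n M).PosSemidef :=
  Matrix.posSemidef_vecMulVec_self_star _

/-- The block-compatible square roots of `σ`, which are the purifications of `σ` read as
matrices. -/
def purifications (q : κ → Type*) [∀ i, Fintype (q i)] (σ : Matrix (Σ i, m i) (Σ i, m i) ℂ) :
    Set (Matrix (Σ i, m i) (Σ i, q i) ℂ) :=
  {M | IsBlock Sigma.fst Sigma.fst M ∧ M * Mᴴ = σ}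

theorem isCompact_purifications (σ : Matrix (Σ i, m i) (Σ i, m i) ℂ) :
    IsCompact (purifications q σ) := by
  have hsub : purifications q σ ⊆ Set.univ.pi fun x => Set.univ.pi fun _ =>
      Metric.closedBall (0 : ℂ) (Real.sqrt (σ x x).re) := by
    rintro M ⟨-, hM⟩ x - y -
    rw [mem_closedBall_zero_iff]
    apply Real.le_sqrt_of_sq_le
    rw [← hM, Matrix.mul_apply, Complex.re_sum]
    have h : ∀ z, (M x z * Mᴴ z x).re = ‖M x z‖ ^ 2 := by
      intro z
      rw [Matrix.conjTranspose_apply, Complex.star_def, Complex.mul_conj, Complex.ofReal_re,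
        Complex.normSq_eq_norm_sq]
    simp only [h]
    exact Finset.single_le_sum (f := fun z => ‖M x z‖ ^ 2) (fun z _ => by positivity)
      (Finset.mem_univ y)
  refine IsCompact.of_isClosed_subset (isCompact_univ_pi fun x => isCompact_univ_pi fun _ =>
    isCompact_closedBall _ _) ?_ hsub
  have hblock : IsClosed {M : Matrix (Σ i, m i) (Σ i, q i) ℂ |
      ∀ x y, x.1 ≠ y.1 → M x y = 0} := by
    simp only [Set.ofPred_forall]
    refine isClosed_iInter fun x => isClosed_iInter fun y => isClosed_iInter fun _ =>
      isClosed_eq ?_ continuous_const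
    fun_prop
  exact hblock.inter (isClosed_eq (by fun_prop) continuous_const)

theorem kronecker_mul_state (n : ℕ) (Z : Matrix (Σ i, q i) (Σ i, q i) ℂ)
    (M : Matrix (Σ i, m i) (Σ i, q i) ℂ) :
    ((1 : Matrix (Fin n → Σ i, m i) (Fin n → Σ i, m i) ℂ) ⊗ₖ tpow n Z) * state n M *
      ((1 : Matrix (Fin n → Σ i, m i) (Fin n → Σ i, m i) ℂ) ⊗ₖ tpow n Z)ᴴ =
      state n (M * Zᵀ) := by
  rw [state, Matrix.mul_vecMulVec, Matrix.vecMulVec_mul, kronecker_mulVec_vec, ← Matrix.star_mulVec,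
    kronecker_mulVec_vec, ← tpow_transpose, ← tpow_mul, state]

theorem exists_commuting_mixture {σ : Matrix (Σ i, m i) (Σ i, m i) ℂ}
    (hne : (purifications q σ).Nonempty) (n : ℕ) :
    ∃ (ι : Type) (_ : Fintype ι) (w : ι → ℝ) (M : ι → Matrix (Σ i, m i) (Σ i, q i) ℂ),
      (∀ i, 0 ≤ w i) ∧ ∑ i, w i = 1 ∧ (∀ i, M i ∈ purifications q σ) ∧
      ∀ V : Matrix (Fin n → Σ i, q i) (Fin n → Σ i, q i) ℂ, PermInvariant V →
        IsBlock (fun v j => (v j).1) (fun w j => (w j).1) V →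
        Commute (∑ i, w i • state n (M i))
          ((1 : Matrix (Fin n → Σ i, m i) (Fin n → Σ i, m i) ℂ) ⊗ₖ V) := by
  obtain ⟨T, hT, hcomm⟩ := exists_mem_forall_commute
    (C := convexHull ℝ (state n '' purifications q σ))
    (Γ := {U | ∃ Z : Matrix (Σ i, q i) (Σ i, q i) ℂ, IsBlock Sigma.fst Sigma.fst Z ∧
      Zᴴ * Z = 1 ∧ U = (1 : Matrix (Fin n → Σ i, m i) (Fin n → Σ i, m i) ℂ) ⊗ₖ tpow n Z})
    (isCompact_convexHull ((isCompact_purifications σ).image (continuous_state n)))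
    (convex_convexHull ℝ _) (hne.image _).convexHull
    (by
      rintro _ ⟨Z, -, hZ, rfl⟩
      rw [Matrix.conjTranspose_kronecker, ← Matrix.mul_kronecker_mul, ← tpow_conjTranspose,
        ← tpow_mul, hZ, tpow_one]
      simp)
    (by
      rintro _ ⟨Z, hZb, hZ, rfl⟩ X hX
      obtain ⟨ι, _, w, z, hw, hw1, hz, rfl⟩ := mem_convexHull_iff_exists_fintype.mp hX
      choose M hM hMz using hz
      refine mem_convexHull_of_exists_fintype w (fun i => state n (M i * Zᵀ)) hw hw1
        (fun i => Set.mem_image_of_mem _ ⟨(hM i).1.mul hZb.transpose, ?_⟩) ?_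
      · rw [Matrix.conjTranspose_mul, Matrix.mul_assoc, ← Matrix.mul_assoc Zᵀ]
        have : Zᵀ * Zᵀᴴ = 1 := by
          rw [Matrix.conjTranspose_transpose_eq_transpose_conjTranspose, ← Matrix.transpose_mul, hZ,
            Matrix.transpose_one]
        rw [this, Matrix.one_mul, (hM i).2]
      · simp only [← hMz, Matrix.mul_sum, Matrix.sum_mul, Matrix.mul_smul, Matrix.smul_mul,
          kronecker_mul_state])
  obtain ⟨ι, _, w, z, hw, hw1, hz, rfl⟩ := mem_convexHull_iff_exists_fintype.mp hT
  choose M hM hMz using hz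
  refine ⟨ι, inferInstance, w, M, hw, hw1, hM, fun V hV hVb => ?_⟩
  simp only [hMz]
  refine commute_kronecker_of_symmetric (fun Z hZb hZ => hcomm _ ⟨Z, hZb, hZ, rfl⟩) hV ?_
  rintro v w ⟨j, hj⟩
  exact hVb v w fun h => hj (congrFun h j)

/-- For a mixture commuting with all block-diagonal permutation-invariant operators on the
purifying systems, a symmetric purification is dominated by a multiple of the mixture. -/
theorem posSemidef_choose_smul_sub {σ : Matrix (Σ i, m i) (Σ i, m i) ℂ} (hσ : σ.IsHermitian)
    (hσb : IsBlock Sigma.fst Sigma.fst σ)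
    {N : Matrix (Fin n → Σ i, m i) (Fin n → Σ i, q i) ℂ} (hNs : PermInvariant N)
    (hN : IsBlock (fun v j => (v j).1) (fun w j => (w j).1) N) (hNσ : N * Nᴴ = tpow n σ)
    {ι : Type*} [Fintype ι] {w : ι → ℝ} {M : ι → Matrix (Σ i, m i) (Σ i, q i) ℂ}
    (hw : ∀ i, 0 ≤ w i) (hw1 : ∑ i, w i = 1) (hM : ∀ i, M i ∈ purifications q σ)
    (hcomm : ∀ V : Matrix (Fin n → Σ i, q i) (Fin n → Σ i, q i) ℂ, PermInvariant V →
        IsBlock (fun v j => (v j).1) (fun w j => (w j).1) V →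
        Commute (∑ i, w i • state n (M i))
          ((1 : Matrix (Fin n → Σ i, m i) (Fin n → Σ i, m i) ℂ) ⊗ₖ V)) :
    (((n + (∑ i, Fintype.card (m i) * Fintype.card (q i)) - 1).choose n : ℂ) •
      (∑ i, w i • state n (M i)) - Matrix.vecMulVec (vec N) (star (vec N))).PosSemidef := by
  set T := ∑ i, w i • state n (M i) with hTdef
  have hT : T.PosSemidef := Matrix.posSemidef_sum _ fun i _ =>
    (posSemidef_state n (M i)).smul (hw i)
  have hTapp : ∀ p p', T p p' =
      ∑ i, w i • (tpow n (M i) p.1 p.2 * star (tpow n (M i) p'.1 p'.2)) := by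
    intro p p'
    simp [hTdef, Matrix.sum_apply, state, Matrix.vecMulVec_apply, vec_apply]
  have hrank : T.rank ≤ (n + (∑ i, Fintype.card (m i) * Fintype.card (q i)) - 1).choose n := by
    have h := rank_le_choose (X := (Σ i, m i) × (Σ i, q i)) (fun p => p.1.1 = p.2.1)
      (Equiv.arrowProdEquivProdArrow (Fin n) (fun _ => Σ i, m i) (fun _ => Σ i, q i)).symm
      (T := T) ?_ ?_
    · convert h using 2
      have : Fintype.card {p : (Σ i, m i) × (Σ i, q i) // p.1.1 = p.2.1} =
          ∑ i, Fintype.card (m i) * Fintype.card (q i) := by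
        have hcard : ∀ i, (∑ y : Σ i, q i, if i = y.1 then 1 else 0) = Fintype.card (q i) := by
          intro i
          rw [Fintype.sum_sigma, Finset.sum_eq_single i (fun j _ hj => by simp [hj.symm]) (by simp)]
          simp
        rw [Fintype.card_subtype, Finset.card_filter, Fintype.sum_prod_type, Fintype.sum_sigma]
        refine Finset.sum_congr rfl fun i _ => ?_
        simp only [hcard, Finset.sum_const, Finset.card_univ, smul_eq_mul]
      omega
    · intro π v p
      rw [hTapp, hTapp]
      refine Finset.sum_congr rfl fun i _ => ?_
      congr 2
      exact tpow_comp_perm (M i) π (fun j => (v j).1) (fun j => (v j).2)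
    · rintro v p ⟨j, hj⟩
      rw [hTapp]
      refine Finset.sum_eq_zero fun i _ => ?_
      rw [show tpow n (M i) _ _ = 0 from Finset.prod_eq_zero (Finset.mem_univ j) ((hM i).1 _ _ hj)]
      simp
  have key := posSemidef_smul_sub_of_forall hT (vec N)
    (g := ((n + (∑ i, Fintype.card (m i) * Fintype.card (q i)) - 1).choose n : ℕ))
    (by positivity) ?_
  · simpa using key
  intro ε hε
  obtain ⟨S, hS1, hS2, hSh, hStr⟩ := exists_regularized_inverse hT hε
  refine ⟨S *ᵥ vec N, by rw [Matrix.mulVec_mulVec, hS2, Matrix.one_mulVec], ?_⟩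
  have hSM : ∀ i, star (S *ᵥ vec N) ⬝ᵥ vec N = star (vec (tpow n (M i))) ⬝ᵥ
      (S *ᵥ vec (tpow n (M i))) := by
    intro i
    obtain ⟨V, hVs, hVb, hV1, hV2⟩ := exists_intertwiner hσ hσb (hM i).1 (hM i).2 hNs hN hNσ
    have hc := hcomm Vᵀ (fun π v w => hVs π w v) hVb.transpose
    set K := (1 : Matrix (Fin n → Σ i, m i) (Fin n → Σ i, m i) ℂ) ⊗ₖ Vᵀ with hK
    have hcS : S * K = K * S := by
      have h1 : (T + (ε : ℂ) • 1) * K = K * (T + (ε : ℂ) • 1) := by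
        rw [Matrix.add_mul, Matrix.mul_add, hc.eq]
        simp
      calc S * K = S * K * ((T + (ε : ℂ) • 1) * S) := by rw [hS2, Matrix.mul_one]
        _ = S * (K * (T + (ε : ℂ) • 1)) * S := by simp only [Matrix.mul_assoc]
        _ = (S * (T + (ε : ℂ) • 1)) * K * S := by rw [← h1]; simp only [Matrix.mul_assoc]
        _ = K * S := by rw [hS1, Matrix.one_mul]
    have hK1 : K *ᵥ vec (tpow n (M i)) = vec N := by
      rw [hK, kronecker_mulVec_vec, Matrix.transpose_transpose, hV1]
    have hK2 : Kᴴ *ᵥ vec N = vec (tpow n (M i)) := by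
      rw [hK, Matrix.conjTranspose_kronecker, Matrix.conjTranspose_one, kronecker_mulVec_vec, ← hV2]
      rfl
    calc star (S *ᵥ vec N) ⬝ᵥ vec N = star (vec N) ⬝ᵥ (S *ᵥ vec N) := by
          rw [Matrix.star_mulVec, hSh, Matrix.dotProduct_mulVec]
      _ = star (vec N) ⬝ᵥ (K *ᵥ (S *ᵥ vec (tpow n (M i)))) := by
          rw [Matrix.mulVec_mulVec, ← hcS, ← Matrix.mulVec_mulVec, hK1]
      _ = _ := by
          rw [Matrix.dotProduct_mulVec, ← hK2, Matrix.star_mulVec,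
            Matrix.conjTranspose_conjTranspose, hK2]
  have htr : star (S *ᵥ vec N) ⬝ᵥ vec N = (S * T).trace := by
    rw [hTdef, Matrix.mul_sum, Matrix.trace_sum]
    simp only [Matrix.mul_smul, Matrix.trace_smul, state, Matrix.mul_vecMulVec,
      Matrix.trace_vecMulVec]
    calc star (S *ᵥ vec N) ⬝ᵥ vec N = ∑ i, w i • (star (S *ᵥ vec N) ⬝ᵥ vec N) := by
          rw [← Finset.sum_smul, hw1, one_smul]
      _ = _ := Finset.sum_congr rfl fun i _ => by rw [hSM i, dotProduct_comm]
  rw [htr]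
  exact hStr.trans (by exact_mod_cast hrank)

end Reduction

end DeFinetti

open DeFinetti
open scoped Matrix

/-- **Theorem 2.4 (de Finetti reduction with symmetries and fixed marginal).** -/
theorem deFinetti_symmetries_fixed_marginal (n k : ℕ) (hn : 0 < n) (hk : 0 < k)
    (a r : Fin k → ℕ)
    (σhat : Matrix (Σ i : Fin k, Fin (a i)) (Σ i : Fin k, Fin (a i)) ℂ) (hσ : σhat.PosSemidef)
    (Ψ : (Fin n → (Σ i : Fin k, Fin (a i)) × (Σ i : Fin k, Fin (r i))) → ℂ)
    (hsym : SymmetricVec Ψ)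
    (hblock : ∀ v, ¬ (∀ j : Fin n, ((v j).1).1 = ((v j).2).1) → Ψ v = 0)
    (hmarg : ptraceN (outer Ψ) = tensorPow σhat n) :
    ∃ μ : Measure (((Σ i : Fin k, Fin (a i)) × (Σ i : Fin k, Fin (r i))) → ℂ),
      IsProbabilityMeasure μ ∧
      (∀ᵐ φ ∂μ, BlockCompatible φ ∧ ptrace (outer φ) = σhat) ∧
      (∀ v w, Integrable (fun φ => tensorPow (outer φ) n v w) μ) ∧
      (((n + (∑ i, a i * r i) - 1).choose n : ℂ) •
          (Matrix.of fun v w => ∫ φ, tensorPow (outer φ) n v w ∂μ) - outer Ψ).PosSemidef := by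
  let α := Σ i : Fin k, Fin (a i)
  let β := Σ i : Fin k, Fin (r i)
  let N : Matrix (Fin n → α) (Fin n → β) ℂ := Matrix.of fun u z => Ψ fun j => (u j, z j)
  have hNs : PermInvariant N := fun π u z => hsym π fun j => (u j, z j)
  have hN : IsBlock (fun v j => (v j).1) (fun w j => (w j).1) N := fun u z huz =>
    hblock _ fun h => huz (funext h)
  have hNσ : N * Nᴴ = tpow n σhat := by
    ext u u'
    exact congrFun (congrFun hmarg u) u'
  obtain ⟨ι, _, w, M, hw, hw1, hM, hcomm⟩ :=
    exists_commuting_mixture (q := fun i => Fin (r i))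
      (exists_block_purification hn hσ hN hNσ) n
  have hpos := posSemidef_choose_smul_sub hσ.1 (isBlock_of_tpow_eq hn hN hNσ) hNs hN hNσ hw hw1 hM
    hcomm
  let φ : ι → (α × β → ℂ) := fun i xy => M i xy.1 xy.2
  let μ : Measure (α × β → ℂ) := ∑ i, ENNReal.ofReal (w i) • Measure.dirac (φ i)
  have hintegrable : ∀ f : (α × β → ℂ) → ℂ, Integrable f μ := by
    intro f
    refine integrable_finsetSum_measure.mpr fun i _ => ?_
    exact (integrable_dirac (by simp)).smul_measure ENNReal.ofReal_ne_top
  have hintegral : ∀ f : (α × β → ℂ) → ℂ, ∫ x, f x ∂μ = ∑ i, w i • f (φ i) := by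
    intro f
    rw [integral_finsetSum_measure fun i _ => integrable_finsetSum_measure.mp (hintegrable f) i
      (Finset.mem_univ i)]
    refine Finset.sum_congr rfl fun i _ => ?_
    rw [integral_smul_measure, integral_dirac, ENNReal.toReal_ofReal (hw i)]
  refine ⟨μ, ⟨?_⟩, ?_, fun v w => hintegrable _, ?_⟩
  · simp only [μ, Measure.coe_finsetSum, Finset.sum_apply, Measure.smul_apply, measure_univ,
      smul_eq_mul, mul_one]
    rw [← ENNReal.ofReal_sum_of_nonneg fun i _ => hw i, hw1, ENNReal.ofReal_one]
  · have hφ : ∀ i, BlockCompatible (φ i) ∧ ptrace (outer (φ i)) = σhat := fun i =>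
      ⟨fun x y hxy => (hM i).1 x y hxy, (hM i).2⟩
    simp only [μ, ae_iff, Measure.coe_finsetSum, Finset.sum_apply, Measure.smul_apply]
    refine Finset.sum_eq_zero fun i _ => ?_
    have hae : ∀ᵐ x ∂Measure.dirac (φ i), BlockCompatible x ∧ ptrace (outer x) = σhat := by
      rw [ae_dirac_eq]
      exact hφ i
    rw [ae_iff.mp hae, smul_zero]
  · have h := hpos.submatrix
      (Equiv.arrowProdEquivProdArrow (Fin n) (fun _ => α) (fun _ => β))
    convert h using 1
    ext v v'
    simp only [Matrix.sub_apply, Matrix.smul_apply, Matrix.of_apply, outer,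
      Matrix.submatrix_apply, Matrix.sum_apply, state, Matrix.vecMulVec_apply, Pi.star_apply,
      vec_apply, tpow_apply, Fintype.card_fin, tensorPow, Finset.prod_mul_distrib, N, star_prod,
      RCLike.star_def, Equiv.arrowProdEquivProdArrow_apply, Prod.mk.eta]
    exact congrArg (fun c : ℂ => ((n + (∑ i, a i * r i) - 1).choose n : ℂ) • c -
      Ψ v * (starRingEnd ℂ) (Ψ v')) (hintegral fun x =>
        (∏ j, x (v j)) * ∏ j, (starRingEnd ℂ) (x (v' j)))

end
end

section
/- (Lemma 2.6, purification of IID-block-diagonal permutation-invariant matrices) Let n, D, k be positive natural numbers and let Π : Fin k → Matrix (Fin D) (Fin D) ℂ be a family of orthogonal projections (each Π i is Hermitian with (Π i) * (Π i) = Π i, and (Π i) * (Π j) = 0 for i ≠ j). Let ρ be a positive semidefinite, permutation-invariant matrix indexed by (Fin n → Fin D) that is IID-block-diagonal with respect to Π, i.e. ρ = ∑_{f : Fin n → Fin k} (⊗_t Π (f t)) * ρ * (⊗_t Π (f t)). Then there exists a symmetric vector Ψ : (Fin n → Fin D × Fin D) → ℂ such that the partial trace over the second-component systems of |Ψ⟩⟨Ψ|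 equals ρ, and Ψ = ∑_{f : Fin n → Fin k} (⊗_t ((Π (f t)) ⊗ₖ conj (Π (f t)))) *ᵥ Ψ (so Ψ is a purification supported on the symmetric subspace of the direct sum of the matched blocks). -/
open scoped Kronecker ComplexOrder

noncomputable section

/-- Tensor product of a family of matrices:
entries `(⊗_t M t) v w = ∏ t, (M t) (v t) (w t)`. -/
def tensorFam {d : Type*} [Fintype d] {n : ℕ} (M : Fin n → Matrix d d ℂ) :
    Matrix (Fin n → d) (Fin n → d) ℂ :=
  Matrix.of fun v w => ∏ t, M t (v t) (w t)

/-- A matrix on `n` systems is permutation-invariant. -/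
def PermInvariant {d : Type*} {n : ℕ} (ρ : Matrix (Fin n → d) (Fin n → d) ℂ) : Prop :=
  ∀ (π : Equiv.Perm (Fin n)) (v w : Fin n → d), ρ (v ∘ π) (w ∘ π) = ρ v w

/-- Entrywise complex conjugate of a matrix. -/
def matConj {m : Type*} (M : Matrix m m ℂ) : Matrix m m ℂ := M.map (starRingEnd ℂ)

section TensorFamily

variable {d : Type*} [Fintype d] {n : ℕ}

theorem tensorFam_mul_tensorFam (M N : Fin n → Matrix d d ℂ) :
    tensorFam M * tensorFam N = tensorFam fun t => M t * N t := by
  classical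
  ext v w
  simp only [tensorFam, Matrix.mul_apply, Matrix.of_apply, ← Finset.prod_mul_distrib]
  rw [Finset.prod_univ_sum, Fintype.piFinset_univ]

theorem tensorFam_eq_zero {M : Fin n → Matrix d d ℂ} {t : Fin n} (ht : M t = 0) :
    tensorFam M = 0 := by
  ext v w
  exact Finset.prod_eq_zero (Finset.mem_univ t) (by simp [ht])

theorem tensorFam_isHermitian {M : Fin n → Matrix d d ℂ} (hM : ∀ t, (M t).IsHermitian) :
    (tensorFam M).IsHermitian := by
  ext v w
  simp only [tensorFam, Matrix.conjTranspose_apply, Matrix.of_apply, star_prod]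
  exact Finset.prod_congr rfl fun t _ => (hM t).apply _ _

end TensorFamily

open scoped MatrixOrder in
theorem sqrt_posSemidef {m : Type*} [Fintype m] [DecidableEq m] (ρ : Matrix m m ℂ) :
    (CFC.sqrt ρ).PosSemidef :=
  Matrix.nonneg_iff_posSemidef.mp (CFC.sqrt_nonneg ρ)

section OrthogonalProjections

variable {m ι : Type*} [Fintype m] [Fintype ι]
  {T : ι → Matrix m m ℂ} {ρ : Matrix m m ℂ}

/-- A matrix that is block-diagonal for a family of orthogonal projections commutes with them. -/
theorem commute_of_eq_sum_conj (hproj : ∀ f, T f * T f = T f)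
    (horth : ∀ f g, f ≠ g → T f * T g = 0) (hρ : ρ = ∑ f, T f * ρ * T f) (g : ι) :
    Commute ρ (T g) := by
  classical
  have hl : T g * ρ = T g * ρ * T g := by
    conv_lhs => rw [hρ]
    rw [Finset.mul_sum, Finset.sum_eq_single g]
    · rw [← mul_assoc, ← mul_assoc, hproj]
    · intro f _ hf
      rw [← mul_assoc, ← mul_assoc, horth g f hf.symm, zero_mul, zero_mul]
    · simp
  have hr : ρ * T g = T g * ρ * T g := by
    conv_lhs => rw [hρ]
    rw [Finset.sum_mul, Finset.sum_eq_single g]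
    · rw [mul_assoc, hproj]
    · intro f _ hf
      rw [mul_assoc, horth f g hf, mul_zero]
    · simp
  exact hr.trans hl.symm

open scoped MatrixOrder in
/-- The square root of a positive semidefinite block-diagonal matrix is block-diagonal. -/
theorem sqrt_eq_sum_conj [DecidableEq m] (hproj : ∀ f, T f * T f = T f)
    (horth : ∀ f g, f ≠ g → T f * T g = 0) (hpos : ρ.PosSemidef)
    (hρ : ρ = ∑ f, T f * ρ * T f) :
    CFC.sqrt ρ = ∑ f, T f * CFC.sqrt ρ * T f := by
  have hcomm := commute_of_eq_sum_conj hproj horth hρ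
  have hsqrt (g : ι) : Commute (CFC.sqrt ρ) (T g) := (hcomm g).cfcₙ_nnreal NNReal.sqrt
  have hsupp : ρ * ∑ f, T f = ρ := by
    conv_rhs => rw [hρ]
    rw [Finset.mul_sum]
    refine Finset.sum_congr rfl fun f _ => ?_
    rw [← (hcomm f).eq, mul_assoc, hproj]
  have hS : (CFC.sqrt ρ).conjTranspose = CFC.sqrt ρ := (sqrt_posSemidef ρ).isHermitian
  have hker : CFC.sqrt ρ * (1 - ∑ f, T f) = 0 := by
    rw [← Matrix.conjTranspose_mul_self_eq_zero, Matrix.conjTranspose_mul, hS, mul_assoc,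
      ← mul_assoc (CFC.sqrt ρ), CFC.sqrt_mul_sqrt_self ρ hpos.nonneg, mul_sub, hsupp, mul_one,
      sub_self, mul_zero]
  rw [mul_sub, mul_one, sub_eq_zero] at hker
  conv_lhs => rw [hker]
  rw [Finset.mul_sum]
  refine Finset.sum_congr rfl fun f _ => ?_
  rw [← (hsqrt f).eq, mul_assoc, hproj]

end OrthogonalProjections

open scoped MatrixOrder in
/-- The square root of a positive semidefinite permutation-invariant matrix is
permutation-invariant. -/
theorem PermInvariant.sqrt {d : Type*} [Fintype d] [DecidableEq d] {n : ℕ}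
    {ρ : Matrix (Fin n → d) (Fin n → d) ℂ} (hperm : PermInvariant ρ) (hpos : ρ.PosSemidef) :
    PermInvariant (CFC.sqrt ρ) := by
  intro π v w
  let e : (Fin n → d) ≃ (Fin n → d) := Equiv.arrowCongr π.symm (Equiv.refl d)
  have hsq : (CFC.sqrt ρ).submatrix e e * (CFC.sqrt ρ).submatrix e e = ρ := by
    rw [Matrix.submatrix_mul_equiv, CFC.sqrt_mul_sqrt_self ρ hpos.nonneg]
    ext a b
    exact hperm π a b
  have hnonneg : 0 ≤ (CFC.sqrt ρ).submatrix e e :=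
    ((sqrt_posSemidef ρ).submatrix e).nonneg
  have heq : CFC.sqrt ρ = (CFC.sqrt ρ).submatrix e e := CFC.sqrt_unique hsq hnonneg
  exact (congrFun (congrFun heq v) w).symm

/-- The vector on `n` copies of `d × d` whose coordinates are the entries of a matrix. -/
def vecOfMatrix {d : Type*} {n : ℕ} (S : Matrix (Fin n → d) (Fin n → d) ℂ) :
    (Fin n → d × d) → ℂ :=
  fun v => S (fun t => (v t).1) (fun t => (v t).2)

theorem ptraceN_outer_vecOfMatrix {d : Type*} [Fintype d] {n : ℕ}
    (S : Matrix (Fin n → d) (Fin n → d) ℂ) :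
    ptraceN (outer (vecOfMatrix S)) = S * S.conjTranspose := by
  ext u u'
  simp [ptraceN, outer, vecOfMatrix, Matrix.mul_apply]

theorem tensorFam_kronecker_mulVec_vecOfMatrix {d : Type*} [Fintype d] {n : ℕ}
    (M : Fin n → Matrix d d ℂ) (S : Matrix (Fin n → d) (Fin n → d) ℂ) :
    (tensorFam fun t => M t ⊗ₖ matConj (M t)).mulVec (vecOfMatrix S) =
      vecOfMatrix (tensorFam M * S * (tensorFam M).conjTranspose) := by
  ext v
  simp only [Matrix.mulVec, dotProduct, vecOfMatrix, Matrix.mul_apply, Finset.sum_mul]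
  rw [← (Equiv.arrowProdEquivProdArrow (Fin n) (fun _ => d) (fun _ => d)).symm.sum_comp,
    Fintype.sum_prod_type_right]
  refine Finset.sum_congr rfl fun x _ => Finset.sum_congr rfl fun y _ => ?_
  simp only [tensorFam, matConj, Matrix.of_apply, Matrix.conjTranspose_apply, star_prod,
    Matrix.kroneckerMap_apply, Matrix.map_apply, Equiv.arrowProdEquivProdArrow_symm_apply,
    Finset.prod_mul_distrib, starRingEnd_apply]
  ring

/-- **Lemma 2.6 (purification of IID-block-diagonal permutation-invariant matrices).** -/
theorem blockDiag_purification (n D k : ℕ) (hn : 0 < n) (hD : 0 < D) (hk : 0 < k)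
    (P : Fin k → Matrix (Fin D) (Fin D) ℂ)
    (hherm : ∀ i, (P i).IsHermitian) (hproj : ∀ i, P i * P i = P i)
    (horth : ∀ i j, i ≠ j → P i * P j = 0)
    (ρ : Matrix (Fin n → Fin D) (Fin n → Fin D) ℂ)
    (hρ : ρ.PosSemidef) (hperm : PermInvariant ρ)
    (hblock : ρ = ∑ f : Fin n → Fin k,
      (tensorFam fun t => P (f t)) * ρ * (tensorFam fun t => P (f t))) :
    ∃ Ψ : (Fin n → Fin D × Fin D) → ℂ,
      SymmetricVec Ψ ∧
      ptraceN (outer Ψ) = ρ ∧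
      Ψ = ∑ f : Fin n → Fin k,
        (tensorFam fun t => (P (f t)) ⊗ₖ matConj (P (f t))).mulVec Ψ := by
  open scoped MatrixOrder in
  have hT_herm (f : Fin n → Fin k) : (tensorFam fun t => P (f t)).IsHermitian :=
    tensorFam_isHermitian fun t => hherm (f t)
  have hT_proj (f : Fin n → Fin k) : (tensorFam fun t => P (f t)) * (tensorFam fun t => P (f t)) =
      tensorFam fun t => P (f t) := by
    simp only [tensorFam_mul_tensorFam, hproj]
  have hT_orth (f g : Fin n → Fin k) (hfg : f ≠ g) :
      (tensorFam fun t => P (f t)) * (tensorFam fun t => P (g t)) = 0 := by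
    obtain ⟨t, ht⟩ := Function.ne_iff.mp hfg
    rw [tensorFam_mul_tensorFam]
    exact tensorFam_eq_zero (horth _ _ ht)
  have hS : (CFC.sqrt ρ).conjTranspose = CFC.sqrt ρ := (sqrt_posSemidef ρ).isHermitian
  refine ⟨vecOfMatrix (CFC.sqrt ρ),
    fun π v => hperm.sqrt hρ π (fun t => (v t).1) (fun t => (v t).2), ?_, ?_⟩
  · rw [ptraceN_outer_vecOfMatrix, hS, CFC.sqrt_mul_sqrt_self ρ hρ.nonneg]
  · ext v
    simp only [tensorFam_kronecker_mulVec_vecOfMatrix, (hT_herm _).eq, Finset.sum_apply]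
    have hblock_sqrt := sqrt_eq_sum_conj hT_proj hT_orth hρ hblock
    simpa only [vecOfMatrix, Matrix.sum_apply] using
      congrFun (congrFun hblock_sqrt fun t => (v t).1) fun t => (v t).2

end
end
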